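/- Let s ≥ 0, let k be a nonnegative integer, let M > 3, and let m : ℝ³ × ℝ³ → ℂ be a symbol in the class 𝓑_s, i.e.: (1) m(λξ, λη) = λˢ m(ξ, η) for all λ > 0 and all (ξ,η); (2) m is smooth on the complement of {ξ = 0} ∪ {η = 0} ∪ {ξ = η}; (3) for each labeling (ξ₁, ξ₂, ξ₃) of the three frequencies (ξ, η, ξ − η), there exist δ > 0 and a smooth function 𝓐 : ℝ × ℝ³ × ℝ³ → ℂ such that m(ξ, η) = 𝓐(‖ξ₁‖, ξ₁/‖ξ₁‖, ξ₂) whenever 0 < ‖ξ₁‖ ≤ δ and 1/2 ≤ ‖ξ₂‖ ≤ 2. Then there exists a constant C > 0 such that for all Schwartz functions f, g : ℝ³ → ℂ, ‖Λᵏ T_m(f, g)‖_{L²(ℝ³)} ≤ C ( ‖f‖_{H^{s+k}} ‖g‖_{W^{1,M}} + ‖f‖_{W^{1,M}} ‖g‖_{H^{s+k}} ). -/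

import Mathlib

open MeasureTheory
open scoped InnerProductSpace FourierTransform ENNReal

/-- The bilinear pseudo-product operator with symbol m:
T_m(f,g)(x) = ∫ e^{2πi⟨x,ξ⟩} ∫ m(ξ,η) f̂(η) ĝ(ξ−η) dη dξ. -/
noncomputable def pseudoProduct (m : EuclideanSpace ℝ (Fin 3) → EuclideanSpace ℝ (Fin 3) → ℂ)
    (f g : EuclideanSpace ℝ (Fin 3) → ℂ) (x : EuclideanSpace ℝ (Fin 3)) : ℂ :=
  ∫ ξ : EuclideanSpace ℝ (Fin 3),
    Complex.exp (2 * Real.pi * Complex.I * ((⟪x, ξ⟫_ℝ : ℝ) : ℂ)) *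
      ∫ η : EuclideanSpace ℝ (Fin 3), m ξ η * 𝓕 f η * 𝓕 g (ξ - η)

/-- The Fourier multiplier Λ^σ = (2π|∇|)^σ: Λ^σ f is the inverse Fourier transform of
ξ ↦ (2π‖ξ‖)^σ f̂(ξ). -/
noncomputable def lambdaPow (s : ℝ) (f : EuclideanSpace ℝ (Fin 3) → ℂ)
    (x : EuclideanSpace ℝ (Fin 3)) : ℂ :=
  ∫ ξ : EuclideanSpace ℝ (Fin 3),
    Complex.exp (2 * Real.pi * Complex.I * ((⟪x, ξ⟫_ℝ : ℝ) : ℂ)) *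
      (((2 * Real.pi * ‖ξ‖) ^ s : ℝ) : ℂ) * 𝓕 f ξ

/-- The Sobolev norm ‖f‖_{H^σ} = ‖(1 + 4π²‖ξ‖²)^{σ/2} f̂(ξ)‖_{L²}. -/
noncomputable def sobolevH (σ : ℝ) (f : EuclideanSpace ℝ (Fin 3) → ℂ) : ℝ≥0∞ :=
  eLpNorm (fun ξ : EuclideanSpace ℝ (Fin 3) =>
    (((1 + 4 * Real.pi ^ 2 * ‖ξ‖ ^ 2) ^ (σ / 2) : ℝ)) • 𝓕 f ξ) 2 volume

/-- The Sobolev norm ‖f‖_{W^{1,M}} = ‖f‖_{L^M} + ‖∇f‖_{L^M}. -/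
noncomputable def sobolevW1 (M : ℝ) (f : EuclideanSpace ℝ (Fin 3) → ℂ) : ℝ≥0∞ :=
  eLpNorm f (ENNReal.ofReal M) volume +
    eLpNorm (fun x => fderiv ℝ f x) (ENNReal.ofReal M) volume

namespace PseudoProduct

local notation "E3" => EuclideanSpace ℝ (Fin 3)

section Plancherel

variable {V : Type*} [NormedAddCommGroup V] [InnerProductSpace ℝ V] [FiniteDimensional ℝ V]
  [MeasurableSpace V] [BorelSpace V]

theorem integral_fourierInv_mul_eq {b φ : V → ℂ} (hb : Integrable b) (hφ : Integrable φ) :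
    ∫ x, 𝓕⁻ b x * φ x = ∫ x, b x * 𝓕⁻ φ x := by
  have h := VectorFourier.integral_fourierIntegral_smul_eq_flip (L := -innerₗ V)
    (μ := volume) (ν := volume) (f := b) (g := φ)
    Real.continuous_fourierChar (continuous_inner (𝕜 := ℝ) (E := V)).neg hb hφ
  have e1 : VectorFourier.fourierIntegral Real.fourierChar volume (-innerₗ V) b = 𝓕⁻ b := by
    ext x; simp [VectorFourier.fourierIntegral, Real.fourierInv_eq]
  have e2 : VectorFourier.fourierIntegral Real.fourierChar volume (-innerₗ V).flip φ = 𝓕⁻ φ := by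
    ext x; simp [VectorFourier.fourierIntegral, Real.fourierInv_eq, real_inner_comm]
  rw [e1, e2] at h
  simpa using h

theorem continuous_fourierInv {b : V → ℂ} (hb : Integrable b) : Continuous (𝓕⁻ b) := by
  have := VectorFourier.fourierIntegral_continuous (L := -innerₗ V)
    (μ := volume) (f := b)
    Real.continuous_fourierChar (continuous_inner (𝕜 := ℝ) (E := V)).neg hb
  convert this using 1
  ext x; simp [VectorFourier.fourierIntegral, Real.fourierInv_eq]

theorem eLpNorm_fourierInv_le {b : V → ℂ} (hb : Integrable b) (hb2 : MemLp b 2) :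
    eLpNorm (𝓕⁻ b) 2 ≤ eLpNorm b 2 := by
  set B : Lp ℂ 2 (volume : Measure V) := hb2.toLp b with hB
  have hae : 𝓕⁻ b =ᵐ[volume] (𝓕⁻ B : Lp ℂ 2 (volume : Measure V)) := by
    apply ae_eq_of_integral_contDiff_smul_eq
    · exact (continuous_fourierInv hb).locallyIntegrable
    · exact (Lp.memLp (𝓕⁻ B)).locallyIntegrable (by norm_num)
    intro g hg hgs
    have hgs' : HasCompactSupport (fun x => (g x : ℂ)) := hgs.comp_left (g := ((↑) : ℝ → ℂ)) rfl
    set G : SchwartzMap V ℂ := hgs'.toSchwartzMap (Complex.ofRealCLM.contDiff.comp hg) with hG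
    have hGv : ∀ x, G x = g x := fun x => rfl
    have h1 := congrArg (fun T => T G) (Lp.fourierInv_toTemperedDistribution_eq B)
    simp only [TemperedDistribution.fourierInv_apply, Lp.toTemperedDistribution_apply] at h1
    have h2 := integral_fourierInv_mul_eq hb G.integrable
    calc ∫ x, g x • 𝓕⁻ b x = ∫ x, 𝓕⁻ b x * G x := by
          congr with x; rw [hGv]; simp [mul_comm]
      _ = ∫ x, (𝓕⁻ G) x • B x := by
          rw [h2]
          apply integral_congr_ae
          filter_upwards [hb2.coeFn_toLp] with x hx
          rw [SchwartzMap.fourierInv_coe, hB, hx, smul_eq_mul, mul_comm]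
      _ = ∫ x, g x • (𝓕⁻ B : Lp ℂ 2 (volume : Measure V)) x := by
          rw [h1]; congr with x
  rw [eLpNorm_congr_ae hae]
  have h3 : ‖(𝓕⁻ B : Lp ℂ 2 (volume : Measure V))‖ = ‖B‖ :=
    (Lp.fourierTransformₗᵢ V ℂ).symm.norm_map B
  rw [← Lp.enorm_def, ← ofReal_norm, h3, ofReal_norm, Lp.enorm_def,
    eLpNorm_congr_ae hb2.coeFn_toLp]

theorem eLpNorm_schwartz_convolution_le (a b : SchwartzMap V ℂ) {D : ℝ}
    (hD : ∀ x, ‖𝓕⁻ (a : V → ℂ) x‖ ≤ D) :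
    eLpNorm (fun ξ => ∫ η, a η * b (ξ - η)) 2 ≤ ENNReal.ofReal D * eLpNorm b 2 := by
  set c := SchwartzMap.convolution (ContinuousLinearMap.mul ℂ ℂ) a b with hc
  have hcv : (fun ξ => ∫ η, a η * b (ξ - η)) = c := by
    ext ξ
    rw [hc, SchwartzMap.convolution_apply, convolution_def]
    rfl
  have hpl : ∀ u : SchwartzMap V ℂ, eLpNorm ((𝓕 u : SchwartzMap V ℂ) : V → ℂ) 2 volume =
      eLpNorm (u : V → ℂ) 2 volume := by
    intro u
    have h := SchwartzMap.norm_fourier_toL2_eq u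
    rw [SchwartzMap.norm_toLp, SchwartzMap.norm_toLp] at h
    rwa [ENNReal.toReal_eq_toReal_iff' (SchwartzMap.memLp _ 2 volume).eLpNorm_ne_top
      (u.memLp 2 volume).eLpNorm_ne_top] at h
  rw [hcv, ← hpl c, ← hpl b]
  have : ∀ x, 𝓕 c x = 𝓕 a x * 𝓕 b x := by
    intro x
    rw [hc, SchwartzMap.fourier_convolution]
    simp
  have hD' : ∀ x, ‖𝓕 a x‖ ≤ D := by
    intro x
    have := hD (-x)
    rwa [Real.fourierInv_eq_fourier_neg, neg_neg, ← SchwartzMap.fourier_coe] at this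
  have := eLpNorm_le_mul_eLpNorm_of_ae_le_mul
    (f := ((𝓕 c : SchwartzMap V ℂ) : V → ℂ)) (g := ((𝓕 b : SchwartzMap V ℂ) : V → ℂ)) (c := D) (μ := volume)
    (Filter.Eventually.of_forall fun x => by rw [this, norm_mul]; gcongr; exact hD' x) 2
  exact this

theorem eLpNorm_convolution_le (a : SchwartzMap V ℂ) {b : V → ℂ} (hb : MemLp b 2) {D : ℝ}
    (hD : ∀ x, ‖𝓕⁻ (a : V → ℂ) x‖ ≤ D) :
    eLpNorm (fun ξ => ∫ η, a η * b (ξ - η)) 2 ≤ ENNReal.ofReal D * eLpNorm b 2 := by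
  have hdense : ∀ n : ℕ, ∃ u : SchwartzMap V ℂ,
      eLpNorm (b - ⇑u) 2 ≤ ENNReal.ofReal (1 / (n + 1)) := by
    intro n
    obtain ⟨g, hg1, hg2, hg3⟩ := hb.exist_eLpNorm_sub_le (by norm_num) (by norm_num)
      (ε := 1 / ((n : ℝ) + 1)) (by positivity)
    exact ⟨hg1.toSchwartzMap hg2, hg3⟩
  choose u hu using hdense
  have hlim0 : Filter.Tendsto (fun n : ℕ => ENNReal.ofReal (1 / ((n : ℝ) + 1))) Filter.atTop
      (nhds 0) := by
    rw [← ENNReal.ofReal_zero]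
    exact ENNReal.tendsto_ofReal tendsto_one_div_add_atTop_nhds_zero_nat
  have h_int : ∀ (v : V → ℂ), MemLp v 2 → ∀ ξ,
      Integrable (fun η => a η * v (ξ - η)) ∧
      ‖∫ η, a η * v (ξ - η)‖ₑ ≤ eLpNorm a 2 * eLpNorm v 2 := by
    intro v hv ξ
    have hv' : MemLp (fun η => v (ξ - η)) 2 :=
      hv.comp_measurePreserving (Measure.measurePreserving_sub_left volume ξ)
    have hn : eLpNorm (fun η => v (ξ - η)) 2 = eLpNorm v 2 :=
      eLpNorm_comp_measurePreserving hv.1 (Measure.measurePreserving_sub_left volume ξ)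
    refine ⟨(a.memLp 2).integrable_mul hv', ?_⟩
    calc _ ≤ ∫⁻ η, ‖a η * v (ξ - η)‖ₑ := enorm_integral_le_lintegral_enorm _
      _ = eLpNorm (fun η => a η * v (ξ - η)) 1 := by rw [eLpNorm_one_eq_lintegral_enorm]
      _ ≤ eLpNorm a 2 * eLpNorm (fun η => v (ξ - η)) 2 := by
        have := eLpNorm_smul_le_mul_eLpNorm (p := 2) (q := 2) (r := 1) hv'.1 (a.memLp 2 volume).1
        exact this
      _ = _ := by rw [hn]
  have hpt : ∀ ξ, Filter.Tendsto (fun n => ∫ η, a η * u n (ξ - η)) Filter.atTop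
      (nhds (∫ η, a η * b (ξ - η))) := by
    intro ξ
    rw [tendsto_iff_edist_tendsto_0]
    refine tendsto_of_tendsto_of_tendsto_of_le_of_le tendsto_const_nhds
      (h := fun n : ℕ => eLpNorm a 2 * ENNReal.ofReal (1 / ((n : ℝ) + 1))) ?_
      (fun _ => zero_le) ?_
    · simpa using ENNReal.Tendsto.const_mul hlim0 (Or.inr (a.memLp 2 volume).eLpNorm_ne_top)
    · intro n
      change edist _ _ ≤ _
      rw [edist_comm, edist_eq_enorm_sub,
        ← integral_sub (h_int b hb ξ).1 (h_int (u n) ((u n).memLp 2 volume) ξ).1]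
      have h := (h_int (b - ⇑(u n)) (hb.sub ((u n).memLp 2 volume)) ξ).2
      simp only [Pi.sub_apply, mul_sub] at h
      exact h.trans (mul_le_mul' le_rfl (hu n))
  have hfat := Lp.eLpNorm_lim_le_liminf_eLpNorm (p := 2) (μ := (volume : Measure V))
    (f := fun (n : ℕ) ξ => ∫ η, a η * u n (ξ - η)) (fun n => ?_)
    (fun ξ => ∫ η, a η * b (ξ - η)) (Filter.Eventually.of_forall hpt)
  · refine hfat.trans ?_
    have hD0 : 0 ≤ D := (norm_nonneg _).trans (hD 0)
    have hle : ∀ n, eLpNorm (fun ξ => ∫ η, a η * u n (ξ - η)) 2 ≤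
        ENNReal.ofReal D * (eLpNorm b 2 + ENNReal.ofReal (1 / ((n : ℝ) + 1))) := by
      intro n
      refine (eLpNorm_schwartz_convolution_le a (u n) hD).trans ?_
      gcongr
      have hun : MemLp (u n : V → ℂ) 2 volume := (u n).memLp 2 volume
      have hsub := eLpNorm_sub_le (p := 2) hb.1 (hb.sub hun).1 one_le_two
      rw [sub_sub_cancel] at hsub
      exact hsub.trans (add_le_add le_rfl (hu n))
    refine (Filter.liminf_le_liminf (Filter.Eventually.of_forall hle)).trans ?_
    have ht : Filter.Tendsto (fun n : ℕ => ENNReal.ofReal D *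
        (eLpNorm b 2 + ENNReal.ofReal (1 / ((n : ℝ) + 1)))) Filter.atTop
        (nhds (ENNReal.ofReal D * (eLpNorm b 2 + 0))) :=
      ENNReal.Tendsto.const_mul (tendsto_const_nhds.add hlim0) (Or.inr ENNReal.ofReal_ne_top)
    rw [ht.liminf_eq, add_zero]
  · have : (fun ξ => ∫ η, a η * u n (ξ - η)) =
        SchwartzMap.convolution (ContinuousLinearMap.mul ℂ ℂ) a (u n) := by
      ext ξ
      rw [SchwartzMap.convolution_apply, convolution_def]
      rfl
    rw [this]
    exact (SchwartzMap.continuous _).aestronglyMeasurable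

end Plancherel

section Inversion

variable {V : Type*} [NormedAddCommGroup V] [InnerProductSpace ℝ V] [FiniteDimensional ℝ V]
  [MeasurableSpace V] [BorelSpace V]

theorem integral_fourier_mul_eq {b φ : V → ℂ} (hb : Integrable b) (hφ : Integrable φ) :
    ∫ x, 𝓕 b x * φ x = ∫ x, b x * 𝓕 φ x := by
  simpa using! VectorFourier.integral_fourierIntegral_smul_eq_flip (L := innerₗ V)
    Real.continuous_fourierChar continuous_inner hb hφ

theorem fourier_fourierInv_ae_eq {b : V → ℂ} (hb : Integrable b) (hb' : Integrable (𝓕⁻ b)) :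
    𝓕 (𝓕⁻ b) =ᵐ[volume] b := by
  apply ae_eq_of_integral_contDiff_smul_eq
  · have : Continuous (𝓕 (𝓕⁻ b)) := VectorFourier.fourierIntegral_continuous (L := innerₗ V)
      Real.continuous_fourierChar continuous_inner hb'
    exact this.locallyIntegrable
  · exact hb.locallyIntegrable
  intro g hg hgs
  have hgs' : HasCompactSupport (fun x => (g x : ℂ)) := hgs.comp_left (g := ((↑) : ℝ → ℂ)) rfl
  set G : SchwartzMap V ℂ := hgs'.toSchwartzMap (Complex.ofRealCLM.contDiff.comp hg) with hG
  have hGv : ∀ x, G x = g x := fun x => rfl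
  calc ∫ x, g x • 𝓕 (𝓕⁻ b) x = ∫ x, 𝓕 (𝓕⁻ b) x * G x := by
        congr with x; rw [hGv]; simp [mul_comm]
    _ = ∫ x, b x * 𝓕⁻ (𝓕 (G : V → ℂ)) x := by
        rw [integral_fourier_mul_eq hb' G.integrable, ← SchwartzMap.fourier_coe,
          integral_fourierInv_mul_eq hb (𝓕 G : SchwartzMap V ℂ).integrable]
    _ = ∫ x, g x • b x := by
        congr with x
        rw [← SchwartzMap.fourier_coe, ← SchwartzMap.fourierInv_coe,
          FourierTransform.fourierInv_fourier_eq, hGv]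
        simp [mul_comm]

theorem fourierInv_of_not_integrable {b : V → ℂ} (hb : ¬ Integrable b) : 𝓕⁻ b = 0 := by
  ext x
  rw [Real.fourierInv_eq_fourier_neg, Real.fourier_eq, Pi.zero_apply]
  apply integral_undef
  rwa [Real.fourierIntegral_convergent_iff]

theorem fourier_of_not_integrable {b : V → ℂ} (hb : ¬ Integrable b) : 𝓕 b = 0 := by
  ext x
  rw [Real.fourier_eq, Pi.zero_apply]
  apply integral_undef
  rwa [Real.fourierIntegral_convergent_iff]

theorem eLpNorm_fourierInv_mul_fourier_fourierInv_le (w b : V → ℂ) :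
    eLpNorm (𝓕⁻ (fun ξ => w ξ * 𝓕 (𝓕⁻ b) ξ)) 2 ≤ eLpNorm (fun ξ => w ξ * b ξ) 2 := by
  have hzero : ∀ u : V → ℂ, u = 0 → eLpNorm (𝓕⁻ u) 2 ≤ eLpNorm (fun ξ => w ξ * b ξ) 2 := by
    rintro u rfl
    have : 𝓕⁻ (0 : V → ℂ) = 0 := by ext x; simp [Real.fourierInv_eq]
    simp [this]
  by_cases hb' : Integrable (𝓕⁻ b)
  swap
  · apply hzero; ext ξ; simp [fourier_of_not_integrable hb']
  by_cases hb : Integrable b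
  swap
  · apply hzero; ext ξ
    rw [fourierInv_of_not_integrable hb]
    simp [Real.fourier_eq]
  have hae : (fun ξ => w ξ * 𝓕 (𝓕⁻ b) ξ) =ᵐ[volume] fun ξ => w ξ * b ξ := by
    filter_upwards [fourier_fourierInv_ae_eq hb hb'] with ξ hξ
    rw [hξ]
  have heq : 𝓕⁻ (fun ξ => w ξ * 𝓕 (𝓕⁻ b) ξ) = 𝓕⁻ (fun ξ => w ξ * b ξ) := by
    ext x
    rw [Real.fourierInv_eq, Real.fourierInv_eq]
    apply integral_congr_ae
    filter_upwards [hae] with ξ hξ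
    simp only [hξ]
  rw [heq]
  by_cases hw : Integrable (fun ξ => w ξ * b ξ)
  swap
  · rw [fourierInv_of_not_integrable hw]; simp
  by_cases hw2 : eLpNorm (fun ξ => w ξ * b ξ) 2 volume = ∞
  · rw [hw2]; exact le_top
  exact eLpNorm_fourierInv_le hw ⟨hw.1, lt_top_iff_ne_top.2 hw2⟩

end Inversion

theorem eLpNorm_lambdaPow_pseudoProduct_le
    (m : EuclideanSpace ℝ (Fin 3) → EuclideanSpace ℝ (Fin 3) → ℂ) (k : ℕ)
    (f g : EuclideanSpace ℝ (Fin 3) → ℂ) :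
    eLpNorm (lambdaPow k (pseudoProduct m f g)) 2 volume ≤
      ENNReal.ofReal ((2 * Real.pi) ^ k) *
        eLpNorm (fun ξ => ((‖ξ‖ ^ k : ℝ) : ℂ) * ∫ η, m ξ η * 𝓕 f η * 𝓕 g (ξ - η)) 2 volume := by
  set b : EuclideanSpace ℝ (Fin 3) → ℂ := fun ξ => ∫ η, m ξ η * 𝓕 f η * 𝓕 g (ξ - η) with hb
  have h1 : pseudoProduct m f g = 𝓕⁻ b := by
    ext x
    rw [pseudoProduct, Real.fourierInv_eq']
    congr with ξ
    rw [smul_eq_mul, real_inner_comm]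
    congr 2
    push_cast
    ring
  have h2 : lambdaPow k (pseudoProduct m f g) =
      𝓕⁻ (fun ξ => (((2 * Real.pi * ‖ξ‖) ^ (k : ℝ) : ℝ) : ℂ) * 𝓕 (𝓕⁻ b) ξ) := by
    ext x
    rw [lambdaPow, Real.fourierInv_eq', h1]
    congr with ξ
    rw [smul_eq_mul, real_inner_comm, mul_assoc]
    congr 2
    push_cast
    ring
  rw [h2]
  refine (eLpNorm_fourierInv_mul_fourier_fourierInv_le _ b).trans ?_
  apply eLpNorm_le_mul_eLpNorm_of_ae_le_mul
  refine Filter.Eventually.of_forall fun ξ => le_of_eq ?_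
  rw [norm_mul, norm_mul, Real.rpow_natCast, mul_pow]
  rw [Complex.norm_real, Complex.norm_real, norm_mul, mul_assoc]
  congr 1
  rw [Real.norm_of_nonneg (by positivity)]

section Minkowski

variable {Ω X : Type*} [MeasurableSpace Ω] [MeasurableSpace X] {ν : Measure Ω} {μ : Measure X}
  [SFinite ν] [SFinite μ]

theorem lintegral_lintegral_sq_le {F : Ω → X → ℝ≥0∞} (hF : Measurable (Function.uncurry F)) :
    (∫⁻ x, (∫⁻ ω, F ω x ∂ν) ^ (2 : ℝ) ∂μ) ^ (1 / 2 : ℝ) ≤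
      ∫⁻ ω, (∫⁻ x, F ω x ^ (2 : ℝ) ∂μ) ^ (1 / 2 : ℝ) ∂ν := by
  have hF1 : ∀ ω, Measurable (F ω) := fun ω => hF.comp measurable_prodMk_left
  have hF2 : ∀ x, Measurable (fun ω => F ω x) := fun x => hF.comp measurable_prodMk_right
  have hN : Measurable fun ω => (∫⁻ x, F ω x ^ (2 : ℝ) ∂μ) ^ (1 / 2 : ℝ) := by
    refine Measurable.pow_const ?_ _
    exact Measurable.lintegral_prod_right' (f := fun p : Ω × X => F p.1 p.2 ^ (2 : ℝ))
      (hF.pow_const _)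
  have hsw : Measurable fun p : X × Ω => F p.2 p.1 := hF.comp measurable_swap
  have key : ∫⁻ x, (∫⁻ ω, F ω x ∂ν) ^ (2 : ℝ) ∂μ ≤
      (∫⁻ ω, (∫⁻ x, F ω x ^ (2 : ℝ) ∂μ) ^ (1 / 2 : ℝ) ∂ν) ^ (2 : ℝ) := by
    calc ∫⁻ x, (∫⁻ ω, F ω x ∂ν) ^ (2 : ℝ) ∂μ
        = ∫⁻ x, ∫⁻ ω, F ω x * ∫⁻ ω', F ω' x ∂ν ∂ν ∂μ := by
          congr with x
          rw [lintegral_mul_const _ (hF2 x), ENNReal.rpow_two, sq]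
      _ = ∫⁻ ω, ∫⁻ x, F ω x * ∫⁻ ω', F ω' x ∂ν ∂μ ∂ν := by
          apply lintegral_lintegral_swap
          apply Measurable.aemeasurable
          apply hsw.mul
          exact (Measurable.lintegral_prod_right' hsw).comp measurable_fst
      _ = ∫⁻ ω, ∫⁻ ω', ∫⁻ x, F ω x * F ω' x ∂μ ∂ν ∂ν := by
          congr with ω
          rw [← lintegral_lintegral_swap]
          · congr with x
            rw [lintegral_const_mul _ (hF2 x)]
          · apply Measurable.aemeasurable
            exact ((hF1 ω).comp measurable_fst).mul hsw
      _ ≤ ∫⁻ ω, ∫⁻ ω', (∫⁻ x, F ω x ^ (2 : ℝ) ∂μ) ^ (1 / 2 : ℝ) *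
            (∫⁻ x, F ω' x ^ (2 : ℝ) ∂μ) ^ (1 / 2 : ℝ) ∂ν ∂ν := by
          gcongr with ω ω'
          exact ENNReal.lintegral_mul_le_Lp_mul_Lq μ Real.HolderConjugate.two_two
            (hF1 ω).aemeasurable (hF1 ω').aemeasurable
      _ = _ := by
          simp_rw [lintegral_const_mul _ hN]
          rw [lintegral_mul_const _ hN, ENNReal.rpow_two, sq]
  calc _ ≤ ((∫⁻ ω, (∫⁻ x, F ω x ^ (2 : ℝ) ∂μ) ^ (1 / 2 : ℝ) ∂ν) ^ (2 : ℝ)) ^ (1 / 2 : ℝ) := by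
        gcongr
    _ = _ := by rw [← ENNReal.rpow_mul]; norm_num

theorem eLpNorm_integral_le_lintegral_eLpNorm {Φ : Ω → X → ℂ}
    (hΦ : Measurable (Function.uncurry Φ)) :
    eLpNorm (fun x => ∫ ω, Φ ω x ∂ν) 2 μ ≤ ∫⁻ ω, eLpNorm (Φ ω) 2 μ ∂ν := by
  have h := lintegral_lintegral_sq_le (ν := ν) (μ := μ) (F := fun ω x => ‖Φ ω x‖ₑ) hΦ.enorm
  simp only [eLpNorm_eq_lintegral_rpow_enorm_toReal (p := 2) (by norm_num) (by norm_num),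
    ENNReal.toReal_ofNat]
  refine le_trans ?_ h
  gcongr with x
  exact enorm_integral_le_lintegral_enorm _

end Minkowski

section Bernstein

theorem eLpNorm_comp_smul_sub (K : E3 → ℂ) (hK : AEStronglyMeasurable K) {q : ℝ} (hq : 0 < q)
    (τ : ℝ) (x : E3) :
    eLpNorm (fun t => K (Real.exp τ • (t - x))) (ENNReal.ofReal q) =
      ENNReal.ofReal (Real.exp (-(3 * τ / q))) * eLpNorm K (ENNReal.ofReal q) := by
  have hne : Real.exp τ ≠ 0 := (Real.exp_pos τ).ne'
  have hmap : Measure.map (fun t : E3 => Real.exp τ • t) volume =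
      ENNReal.ofReal (Real.exp (-(3 * τ))) • volume := by
    rw [Measure.map_addHaar_smul volume hne]
    congr 2
    rw [finrank_euclideanSpace, Fintype.card_fin, abs_of_pos (by positivity), ← Real.exp_nat_mul,
      ← Real.exp_neg]
    norm_num
  have hac : AEStronglyMeasurable K (Measure.map (fun t : E3 => Real.exp τ • t) volume) := by
    rw [hmap]; exact hK.smul_measure _
  have hcomp : AEStronglyMeasurable (fun t : E3 => K (Real.exp τ • t)) volume :=
    hac.comp_measurable (measurable_const_smul _)
  have h1 : eLpNorm (fun t => K (Real.exp τ • (t - x))) (ENNReal.ofReal q) =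
      eLpNorm (fun t : E3 => K (Real.exp τ • t)) (ENNReal.ofReal q) :=
    eLpNorm_comp_measurePreserving (g := fun t : E3 => K (Real.exp τ • t)) hcomp
      (measurePreserving_sub_right volume x)
  have h2 := eLpNorm_map_measure (p := ENNReal.ofReal q) hac (measurable_const_smul _).aemeasurable
  rw [h1]
  change eLpNorm (K ∘ fun t : E3 => Real.exp τ • t) (ENNReal.ofReal q) volume = _
  rw [← h2, hmap, eLpNorm_smul_measure_of_ne_top ENNReal.ofReal_ne_top, smul_eq_mul]
  congr 1
  rw [ENNReal.toReal_div, ENNReal.toReal_one, ENNReal.toReal_ofReal hq.le,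
    ENNReal.ofReal_rpow_of_pos (Real.exp_pos _), ← Real.exp_mul]
  congr 2
  ring

theorem fourierInv_dilate_mul_fourier {φ : E3 → ℂ} (hφ : Continuous φ) (hφc : HasCompactSupport φ)
    (f : SchwartzMap E3 ℂ) (τ : ℝ) (x : E3) :
    𝓕⁻ (fun η => φ (Real.exp (-τ) • η) * 𝓕 (f : E3 → ℂ) η) x =
      ∫ t, f t * (Real.exp (3 * τ) * 𝓕 φ (Real.exp τ • (t - x))) := by
  have hne : Real.exp (-τ) ≠ 0 := (Real.exp_pos _).ne'
  have hcs : HasCompactSupport fun η : E3 => φ (Real.exp (-τ) • η) := hφc.comp_smul hne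
  have h_int : Integrable fun η : E3 =>
      (Real.fourierChar ⟪η, x⟫_ℝ : ℂ) * φ (Real.exp (-τ) • η) := by
    apply Continuous.integrable_of_hasCompactSupport
    · have : Continuous fun η : E3 => (Real.fourierChar ⟪η, x⟫_ℝ : ℂ) :=
        continuous_subtype_val.comp (Real.continuous_fourierChar.comp (by fun_prop))
      fun_prop
    · exact hcs.mul_left
  have h := integral_fourier_mul_eq f.integrable h_int
  have h1 : 𝓕⁻ (fun η => φ (Real.exp (-τ) • η) * 𝓕 (f : E3 → ℂ) η) x =
      ∫ η, 𝓕 (f : E3 → ℂ) η * ((Real.fourierChar ⟪η, x⟫_ℝ : ℂ) * φ (Real.exp (-τ) • η)) := by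
    rw [Real.fourierInv_eq]
    congr with η
    rw [Circle.smul_def, smul_eq_mul]
    ring
  rw [h1, h]
  congr with t
  congr 1
  rw [Real.fourier_eq, Real.fourier_eq]
  have h2 := Measure.integral_comp_smul (volume : Measure E3)
    (fun η => Real.fourierChar (-⟪η, Real.exp τ • (t - x)⟫_ℝ) • φ η) (Real.exp (-τ))
  have h3 : |(Real.exp (-τ) ^ Module.finrank ℝ E3)⁻¹| = Real.exp (3 * τ) := by
    rw [finrank_euclideanSpace, Fintype.card_fin, abs_of_pos (by positivity), ← Real.exp_nat_mul,
      ← Real.exp_neg]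
    congr 1
    push_cast
    ring
  rw [h3, Complex.real_smul] at h2
  rw [← h2]
  congr with η
  rw [inner_smul_left, inner_smul_right, Circle.smul_def, Circle.smul_def, smul_eq_mul, smul_eq_mul,
    ← mul_assoc, ← Circle.coe_mul, ← AddChar.map_add_eq_mul]
  congr 3
  have : Real.exp (-τ) * (Real.exp τ * ⟪η, t - x⟫_ℝ) = ⟪η, t - x⟫_ℝ := by
    rw [← mul_assoc, ← Real.exp_add]; simp
  simp only [conj_trivial]
  rw [this, inner_sub_right]
  ring

theorem exists_enorm_fourierInv_dilate_le {φ : E3 → ℂ} (hφ : ContDiff ℝ (⊤ : ℕ∞) φ)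
    (hφc : HasCompactSupport φ) {M : ℝ} (hM : 1 < M) :
    ∃ C : ℝ, 0 ≤ C ∧ ∀ (f : SchwartzMap E3 ℂ) (τ : ℝ) (x : E3),
      ‖𝓕⁻ (fun η => φ (Real.exp (-τ) • η) * 𝓕 (f : E3 → ℂ) η) x‖ₑ ≤
        ENNReal.ofReal (C * Real.exp (3 * τ / M)) * eLpNorm f (ENNReal.ofReal M) := by
  set q := M.conjExponent with hq
  have hMq : M.HolderConjugate q := Real.HolderConjugate.conjExponent hM
  set K : SchwartzMap E3 ℂ := 𝓕 (hφc.toSchwartzMap hφ) with hK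
  have hKv : (K : E3 → ℂ) = 𝓕 φ := by rw [hK, SchwartzMap.fourier_coe]; rfl
  have hKm : AEStronglyMeasurable (K : E3 → ℂ) volume := K.continuous.aestronglyMeasurable
  have hfin : eLpNorm (K : E3 → ℂ) (ENNReal.ofReal q) volume ≠ ∞ :=
    (K.memLp (ENNReal.ofReal q) volume).eLpNorm_ne_top
  refine ⟨(eLpNorm (K : E3 → ℂ) (ENNReal.ofReal q) volume).toReal, ENNReal.toReal_nonneg, ?_⟩
  intro f τ x
  rw [fourierInv_dilate_mul_fourier hφ.continuous hφc, ← hKv]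
  have hH : ENNReal.HolderTriple (ENNReal.ofReal q) (ENNReal.ofReal M) 1 := by
    constructor
    rw [← ENNReal.ofReal_inv_of_pos hMq.symm.pos, ← ENNReal.ofReal_inv_of_pos hMq.pos,
      ← ENNReal.ofReal_add (by have := hMq.symm.pos; positivity) (by have := hMq.pos; positivity),
      add_comm, hMq.inv_add_inv_eq_one]
    simp
  calc _ ≤ ∫⁻ t, ‖f t * (Real.exp (3 * τ) * K (Real.exp τ • (t - x)))‖ₑ :=
        enorm_integral_le_lintegral_enorm _
    _ = ∫⁻ t, ENNReal.ofReal (Real.exp (3 * τ)) * ‖K (Real.exp τ • (t - x)) * f t‖ₑ := by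
        congr with t
        rw [enorm_mul, enorm_mul, enorm_mul, ← ofReal_norm (Real.exp (3 * τ) : ℂ),
          Complex.norm_real, Real.norm_of_nonneg (Real.exp_pos _).le]
        ring
    _ = ENNReal.ofReal (Real.exp (3 * τ)) *
          eLpNorm (fun t => K (Real.exp τ • (t - x)) * f t) 1 := by
        rw [lintegral_const_mul' _ _ ENNReal.ofReal_ne_top, eLpNorm_one_eq_lintegral_enorm]
    _ ≤ ENNReal.ofReal (Real.exp (3 * τ)) *
          (eLpNorm (fun t => K (Real.exp τ • (t - x))) (ENNReal.ofReal q) *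
            eLpNorm f (ENNReal.ofReal M)) := by
        gcongr
        refine eLpNorm_smul_le_mul_eLpNorm (r := 1) (f := (f : E3 → ℂ))
          (φ := fun t => K (Real.exp τ • (t - x))) f.continuous.aestronglyMeasurable ?_
        exact (K.continuous.comp (by fun_prop)).aestronglyMeasurable
    _ = _ := by
        rw [eLpNorm_comp_smul_sub _ hKm hMq.symm.pos, ← mul_assoc, ← mul_assoc,
          ← ENNReal.ofReal_mul (Real.exp_pos _).le, ← Real.exp_add,
          mul_comm _ (Real.exp (3 * τ / M)),
          ENNReal.ofReal_mul (Real.exp_pos _).le, ENNReal.ofReal_toReal hfin]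
        congr 4
        have := hMq.inv_add_inv_eq_one
        rw [div_eq_mul_inv, div_eq_mul_inv, ← sub_eq_iff_eq_add'.2 this.symm]
        ring


theorem fourier_partialDeriv (f : SchwartzMap E3 ℂ) (i : Fin 3) :
    ∃ g : SchwartzMap E3 ℂ, (∀ η : E3, 𝓕 (g : E3 → ℂ) η =
      2 * Real.pi * Complex.I * (η i : ℂ) * 𝓕 (f : E3 → ℂ) η) ∧
      ∀ x, ‖g x‖ ≤ ‖fderiv ℝ f x‖ := by
  refine ⟨LineDeriv.lineDerivOp (EuclideanSpace.single i (1 : ℝ)) f, ?_, ?_⟩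
  · intro η
    rw [← SchwartzMap.fourier_coe, SchwartzMap.fourier_lineDerivOp_eq, ← SchwartzMap.fourier_coe]
    have : (inner ℝ · (EuclideanSpace.single i (1 : ℝ)) : E3 → ℝ).HasTemperateGrowth :=
      ((innerSL ℝ).flip (EuclideanSpace.single i (1 : ℝ))).hasTemperateGrowth
    rw [_root_.smul_apply, SchwartzMap.smulLeftCLM_apply_apply this]
    simp [EuclideanSpace.inner_single_right, mul_assoc]
  · intro x
    rw [SchwartzMap.lineDerivOp_apply_eq_fderiv]
    have := (fderiv ℝ f x).le_opNorm (EuclideanSpace.single i (1 : ℝ))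
    simpa using this

theorem exists_enorm_fourierInv_dilate_le_sobolevW1 {φ : E3 → ℂ} (hφ : ContDiff ℝ (⊤ : ℕ∞) φ)
    (hφc : HasCompactSupport φ) (hφ0 : φ =ᶠ[nhds 0] 0) {M : ℝ} (hM : 1 < M) :
    ∃ C : ℝ, 0 ≤ C ∧ ∀ (f : SchwartzMap E3 ℂ) (τ : ℝ) (x : E3),
      ‖𝓕⁻ (fun η => φ (Real.exp (-τ) • η) * 𝓕 (f : E3 → ℂ) η) x‖ₑ ≤
        ENNReal.ofReal (C * min (Real.exp (3 * τ / M)) (Real.exp (-(1 - 3 / M) * τ))) *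
          sobolevW1 M f := by
  obtain ⟨C₀, hC₀, h₀⟩ := exists_enorm_fourierInv_dilate_le hφ hφc hM
  set ψ : Fin 3 → E3 → ℂ := fun i η =>
    φ η * ((η i * (2 * Real.pi * ‖η‖ ^ 2)⁻¹ : ℝ) : ℂ) * (-Complex.I) with hψ
  have hψs : ∀ i, ContDiff ℝ (⊤ : ℕ∞) (ψ i) := by
    intro i
    rw [contDiff_iff_contDiffAt]
    intro η
    by_cases hη : η = 0
    · subst hη
      have : ψ i =ᶠ[nhds 0] fun _ => 0 := by
        filter_upwards [hφ0] with η h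
        simp [hψ, h]
      exact contDiffAt_const.congr_of_eventuallyEq this
    · have h1 : ContDiffAt ℝ (⊤ : ℕ∞) (fun η : E3 => η i * (2 * Real.pi * ‖η‖ ^ 2)⁻¹) η := by
        apply ContDiffAt.mul
        · fun_prop
        · apply ContDiffAt.inv
          · exact contDiffAt_const.mul (contDiff_norm_sq ℝ).contDiffAt
          · have := norm_pos_iff.2 hη
            positivity
      exact (hφ.contDiffAt.mul (Complex.ofRealCLM.contDiff.contDiffAt.comp η h1)).mul
        contDiffAt_const
  have hψc : ∀ i, HasCompactSupport (ψ i) := fun i => (hφc.mul_right).mul_right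
  have hrep : ∀ η : E3, φ η = ∑ i, ψ i η * (2 * Real.pi * Complex.I * (η i : ℂ)) := by
    intro η
    by_cases hη : η = 0
    · subst hη
      simp [hφ0.eq_of_nhds]
    · have hn : ‖η‖ ≠ 0 := norm_ne_zero_iff.2 hη
      have hs : ∑ i, (η i : ℂ) ^ 2 = ((‖η‖ ^ 2 : ℝ) : ℂ) := by
        rw [EuclideanSpace.norm_sq_eq]
        push_cast
        congr with i
        rw [← Complex.ofReal_pow, ← Complex.ofReal_pow]; simp
      have : ∀ i, ψ i η * (2 * Real.pi * Complex.I * (η i : ℂ)) =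
          φ η * (((‖η‖ ^ 2)⁻¹ : ℝ) : ℂ) * (η i : ℂ) ^ 2 := by
        intro i
        have hpi : (Real.pi : ℂ) ≠ 0 := by exact_mod_cast Real.pi_ne_zero
        have hnc : (‖η‖ : ℂ) ≠ 0 := by exact_mod_cast hn
        simp only [hψ]
        push_cast
        field_simp
        rw [Complex.I_sq]; ring
      simp_rw [this]
      rw [← Finset.mul_sum, hs, mul_assoc, ← Complex.ofReal_mul, inv_mul_cancel₀ (by positivity)]
      simp
  choose C hC h using fun i => exists_enorm_fourierInv_dilate_le (hψs i) (hψc i) hM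
  have hlow : ∀ (f : SchwartzMap E3 ℂ) (τ : ℝ) (x : E3),
      ‖𝓕⁻ (fun η => φ (Real.exp (-τ) • η) * 𝓕 (f : E3 → ℂ) η) x‖ₑ ≤
        ENNReal.ofReal (C₀ * Real.exp (3 * τ / M)) * sobolevW1 M f := fun f τ x =>
    (h₀ f τ x).trans (by gcongr; exact le_self_add)
  have hhigh : ∀ (f : SchwartzMap E3 ℂ) (τ : ℝ) (x : E3),
      ‖𝓕⁻ (fun η => φ (Real.exp (-τ) • η) * 𝓕 (f : E3 → ℂ) η) x‖ₑ ≤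
        ENNReal.ofReal ((∑ i, C i) * Real.exp (-(1 - 3 / M) * τ)) * sobolevW1 M f := by
    intro f τ x
    choose g hg hgn using fourier_partialDeriv f
    have hgi : ∀ i, Integrable fun η : E3 => Real.fourierChar ⟪η, x⟫_ℝ •
        (ψ i (Real.exp (-τ) • η) * 𝓕 (g i : E3 → ℂ) η) := by
      intro i
      apply Continuous.integrable_of_hasCompactSupport
      · have h1 : Continuous fun η : E3 => Real.fourierChar ⟪η, x⟫_ℝ :=
          Real.continuous_fourierChar.comp (by fun_prop)
        have h2 : Continuous (𝓕 (g i : E3 → ℂ)) := by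
          rw [← SchwartzMap.fourier_coe]; exact SchwartzMap.continuous _
        have h3 := (hψs i).continuous
        fun_prop
      · have := ((hψc i).comp_smul (Real.exp_pos (-τ)).ne').mul_right (f' := 𝓕 (g i : E3 → ℂ))
        exact this.smul_left
    have e : 𝓕⁻ (fun η => φ (Real.exp (-τ) • η) * 𝓕 (f : E3 → ℂ) η) x =
        ∑ i, (Real.exp (-τ) : ℂ) * 𝓕⁻ (fun η => ψ i (Real.exp (-τ) • η) * 𝓕 (g i : E3 → ℂ) η) x := by
      simp_rw [Real.fourierInv_eq]
      rw [← Finset.mul_sum, ← integral_finsetSum _ (fun i _ => hgi i), ← integral_const_mul]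
      congr with η
      simp only [Circle.smul_def, smul_eq_mul, hg]
      rw [hrep, Finset.sum_mul, Finset.mul_sum, Finset.mul_sum]
      congr with i
      simp only [PiLp.smul_apply, smul_eq_mul]
      push_cast
      ring
    rw [e]
    refine (enorm_sum_le _ _).trans ?_
    rw [Finset.sum_mul, ENNReal.ofReal_sum_of_nonneg
      (fun i _ => mul_nonneg (hC i) (Real.exp_pos _).le), Finset.sum_mul]
    apply Finset.sum_le_sum
    intro i _
    have hgl : eLpNorm (g i) (ENNReal.ofReal M) volume ≤ sobolevW1 M f :=
      (eLpNorm_mono (hgn i)).trans le_add_self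
    rw [enorm_mul, ← ofReal_norm (Real.exp (-τ) : ℂ), Complex.norm_real,
      Real.norm_of_nonneg (Real.exp_pos _).le]
    calc _ ≤ ENNReal.ofReal (Real.exp (-τ)) * (ENNReal.ofReal (C i * Real.exp (3 * τ / M)) *
            sobolevW1 M f) := by gcongr; exact (h i (g i) τ x).trans (by gcongr)
      _ = _ := by
        rw [← mul_assoc, ← ENNReal.ofReal_mul (Real.exp_pos _).le, mul_left_comm, ← Real.exp_add]
        congr 4
        ring
  refine ⟨max C₀ (∑ i, C i), le_max_of_le_left hC₀, ?_⟩
  intro f τ x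
  rcases le_total (Real.exp (3 * τ / M)) (Real.exp (-(1 - 3 / M) * τ)) with h' | h'
  · rw [min_eq_left h']
    exact (hlow f τ x).trans (by gcongr; exact le_max_left _ _)
  · rw [min_eq_right h']
    exact (hhigh f τ x).trans (by gcongr; exact le_max_right _ _)

theorem lintegral_min_exp_lt_top {M : ℝ} (hM : 3 < M) (C : ℝ) :
    ∫⁻ τ : ℝ, ENNReal.ofReal (C * min (Real.exp (3 * τ / M)) (Real.exp (-(1 - 3 / M) * τ))) < ∞ := by
  have ha : 0 < 3 / M := by positivity
  have hb : 0 < 1 - 3 / M := by rw [sub_pos, div_lt_one (by linarith)]; exact hM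
  have h_int : Integrable fun τ : ℝ =>
      min (Real.exp (3 * τ / M)) (Real.exp (-(1 - 3 / M) * τ)) := by
    rw [← integrableOn_univ, ← Set.Iic_union_Ioi (a := (0 : ℝ))]
    have hm : ∀ s, AEStronglyMeasurable
      (fun τ : ℝ => min (Real.exp (3 * τ / M)) (Real.exp (-(1 - 3 / M) * τ)))
        (volume.restrict s) := fun s => Continuous.aestronglyMeasurable (by fun_prop)
    apply IntegrableOn.union
    · have h1 : IntegrableOn (fun τ : ℝ => Real.exp (3 / M * τ)) (Set.Iic 0) :=
        integrableOn_exp_mul_Iic ha 0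
      refine h1.mono' (hm _) (Filter.Eventually.of_forall fun τ => ?_)
      rw [Real.norm_of_nonneg (by positivity)]
      refine (min_le_left _ _).trans (le_of_eq ?_)
      congr 1; ring
    · have h1 : IntegrableOn (fun τ : ℝ => Real.exp (-(1 - 3 / M) * τ)) (Set.Ioi 0) :=
        integrableOn_exp_mul_Ioi (neg_lt_zero.2 hb) 0
      refine h1.mono' (hm _) (Filter.Eventually.of_forall fun τ => ?_)
      rw [Real.norm_of_nonneg (by positivity)]
      exact min_le_right _ _
  exact (h_int.const_mul C).lintegral_lt_top

end Bernstein

section TensorRepresentation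

variable {P V : Type*} [NormedAddCommGroup P] [NormedSpace ℝ P] [FiniteDimensional ℝ P]
  [NormedAddCommGroup V] [InnerProductSpace ℝ V] [FiniteDimensional ℝ V]

/-- A compactly supported smooth function on a product is an absolutely convergent superposition
of products of characters of the two factors. -/
theorem exists_tensor_characters {G : P × V → ℂ} (hG : ContDiff ℝ (⊤ : ℕ∞) G)
    (hGc : HasCompactSupport G) :
    ∃ (n : ℕ) (c : EuclideanSpace ℝ (Fin n) → ℂ) (ℓ : EuclideanSpace ℝ (Fin n) → P → ℝ)
      (Y : EuclideanSpace ℝ (Fin n) → V),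
      Continuous c ∧ Integrable c ∧ Continuous (Function.uncurry ℓ) ∧ Continuous Y ∧
      (∀ w p q, ℓ w (p + q) = ℓ w p + ℓ w q) ∧
      ∀ p v, G (p, v) =
        ∫ w, c w * ((Real.fourierChar (ℓ w p) : ℂ) * (Real.fourierChar ⟪Y w, v⟫_ℝ : ℂ)) := by
  let n := Module.finrank ℝ (P × V)
  let W := EuclideanSpace ℝ (Fin n)
  have hn : Module.finrank ℝ (P × V) = Module.finrank ℝ W := by simp [n, W]
  let e : (P × V) ≃L[ℝ] W := ContinuousLinearEquiv.ofFinrankEq hn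
  have hK : HasCompactSupport (G ∘ e.symm) := hGc.comp_homeomorph e.symm.toHomeomorph
  have hKs : ContDiff ℝ (⊤ : ℕ∞) (G ∘ e.symm) := hG.comp e.symm.contDiff
  let K : SchwartzMap W ℂ := hK.toSchwartzMap hKs
  let c : SchwartzMap W ℂ := 𝓕 K
  let L : V →L[ℝ] W := (e : (P × V) →L[ℝ] W).comp (ContinuousLinearMap.inr ℝ P V)
  refine ⟨n, c, fun w p => ⟪w, e (p, 0)⟫_ℝ, fun w => ContinuousLinearMap.adjoint L w,
    c.continuous, c.integrable, ?_, by fun_prop, ?_, ?_⟩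
  · unfold Function.uncurry
    fun_prop
  · intro w p q
    rw [← inner_add_right, ← map_add]
    simp
  · intro p v
    have h1 : G (p, v) = K (e (p, v)) := by
      change _ = (G ∘ e.symm) (e (p, v))
      simp
    have h2 : K = 𝓕⁻ c := by simp [c]
    rw [h1, h2, SchwartzMap.fourierInv_coe, Real.fourierInv_eq]
    congr with w
    have h3 : e (p, v) = e (p, 0) + L v := by
      simp [L, ← map_add]
    rw [h3, inner_add_right, AddChar.map_add_eq_mul, ContinuousLinearMap.adjoint_inner_left,
      Circle.smul_def, smul_eq_mul, Circle.coe_mul, mul_comm]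

end TensorRepresentation

section Piece

theorem contDiff_fourierChar {n : WithTop ℕ∞} :
    ContDiff ℝ n fun t : ℝ => (Real.fourierChar t : ℂ) := by
  simp_rw [Real.fourierChar_apply]
  exact ((Complex.ofRealCLM.contDiff.comp (contDiff_const.mul contDiff_id)).mul contDiff_const).cexp

theorem exists_schwartz_modulated_dilate {φ : E3 → ℂ} (hφ : ContDiff ℝ (⊤ : ℕ∞) φ)
    (hφc : HasCompactSupport φ) (f : SchwartzMap E3 ℂ) (r : ℝ) (hr : r ≠ 0) (v : E3) :
    ∃ a : SchwartzMap E3 ℂ,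
      (∀ η, a η = φ (r • η) * (Real.fourierChar ⟪v, r • η⟫_ℝ : ℂ) * 𝓕 (f : E3 → ℂ) η) ∧
      ∀ x, 𝓕⁻ (a : E3 → ℂ) x = 𝓕⁻ (fun η => φ (r • η) * 𝓕 (f : E3 → ℂ) η) (x + r • v) := by
  have hs : ContDiff ℝ (⊤ : ℕ∞) fun η =>
      φ (r • η) * (Real.fourierChar ⟪v, r • η⟫_ℝ : ℂ) * 𝓕 (f : E3 → ℂ) η := by
    have h1 : ContDiff ℝ (⊤ : ℕ∞) (𝓕 (f : E3 → ℂ)) := by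
      rw [← SchwartzMap.fourier_coe]
      exact (𝓕 f : SchwartzMap E3 ℂ).smooth _
    have h2 : ContDiff ℝ (⊤ : ℕ∞) fun η : E3 => φ (r • η) := hφ.comp (contDiff_const_smul r)
    have h3 : ContDiff ℝ (⊤ : ℕ∞) fun η : E3 => (Real.fourierChar ⟪v, r • η⟫_ℝ : ℂ) :=
      contDiff_fourierChar.comp (contDiff_const.inner ℝ (contDiff_const_smul r))
    exact (h2.mul h3).mul h1
  have hc : HasCompactSupport fun η =>
      φ (r • η) * (Real.fourierChar ⟪v, r • η⟫_ℝ : ℂ) * 𝓕 (f : E3 → ℂ) η :=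
    (hφc.comp_smul hr).mul_right.mul_right
  refine ⟨hc.toSchwartzMap hs, fun η => rfl, fun x => ?_⟩
  have e : ((hc.toSchwartzMap hs : SchwartzMap E3 ℂ) : E3 → ℂ) = fun η =>
      φ (r • η) * (Real.fourierChar ⟪v, r • η⟫_ℝ : ℂ) * 𝓕 (f : E3 → ℂ) η := rfl
  rw [e, Real.fourierInv_eq, Real.fourierInv_eq]
  congr with η
  rw [inner_add_right, AddChar.map_add_eq_mul, inner_smul_right, inner_smul_right,
    real_inner_comm v η]
  simp only [Circle.smul_def, Circle.coe_mul, smul_eq_mul]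
  ring

theorem exists_schwartz_norm_eq (σ : ℝ) (g : SchwartzMap E3 ℂ) :
    ∃ h : SchwartzMap E3 ℂ, ∀ ζ, ‖h ζ‖ = (1 + ‖ζ‖ ^ 2) ^ (σ / 2) * ‖𝓕 (g : E3 → ℂ) ζ‖ := by
  have ht := Function.hasTemperateGrowth_one_add_norm_sq_rpow E3 (σ / 2)
  refine ⟨SchwartzMap.smulLeftCLM ℂ (fun x : E3 => (1 + ‖x‖ ^ 2) ^ (σ / 2)) (𝓕 g), fun ζ => ?_⟩
  rw [SchwartzMap.smulLeftCLM_apply_apply ht, norm_smul, SchwartzMap.fourier_coe,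
    Real.norm_of_nonneg (by positivity)]

theorem rpow_norm_le {σ a : ℝ} (hσ : 0 ≤ σ) (ha : 1 ≤ a) (ζ : E3) :
    ‖ζ‖ ^ σ ≤ (1 + a * ‖ζ‖ ^ 2) ^ (σ / 2) := by
  have h : ‖ζ‖ ^ σ = (‖ζ‖ ^ 2) ^ (σ / 2) := by
    rw [← Real.rpow_natCast, ← Real.rpow_mul (norm_nonneg _)]
    congr 1
    push_cast
    ring
  rw [h]
  apply Real.rpow_le_rpow (by positivity) _ (by positivity)
  nlinarith [sq_nonneg ‖ζ‖]

theorem memLp_of_norm_le_rpow_mul_fourier {σ : ℝ} (hσ : 0 ≤ σ) (g : SchwartzMap E3 ℂ) {b : E3 → ℂ}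
    (hb : Measurable b) {C : ℝ} (hC : 0 ≤ C)
    (hbC : ∀ ζ, ‖b ζ‖ ≤ C * (‖ζ‖ ^ σ * ‖𝓕 (g : E3 → ℂ) ζ‖)) :
    MemLp b 2 ∧ eLpNorm b 2 volume ≤ ENNReal.ofReal C * sobolevH σ g := by
  constructor
  · obtain ⟨h, hh⟩ := exists_schwartz_norm_eq σ g
    refine ((h.memLp 2 volume).norm.const_mul C).mono hb.aestronglyMeasurable
      (.of_forall fun ζ => ?_)
    refine (hbC ζ).trans ?_
    rw [Real.norm_of_nonneg (by positivity), hh]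
    gcongr
    simpa using rpow_norm_le hσ le_rfl ζ
  · have h4 : (1 : ℝ) ≤ 4 * Real.pi ^ 2 := by nlinarith [Real.pi_gt_three]
    have := eLpNorm_le_mul_eLpNorm_of_ae_le_mul (c := C) (p := 2) (μ := volume) (f := b)
      (g := fun ξ : E3 => (((1 + 4 * Real.pi ^ 2 * ‖ξ‖ ^ 2) ^ (σ / 2) : ℝ)) • 𝓕 (g : E3 → ℂ) ξ)
      (.of_forall fun ζ => by
        refine (hbC ζ).trans ?_
        rw [norm_smul, Real.norm_of_nonneg (by positivity)]
        gcongr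
        exact rpow_norm_le hσ h4 ζ)
    exact this

theorem integrable_dilate_mul {W : Type*} [MeasureSpace W] [SFinite (volume : Measure W)]
    {χ : E3 → ℝ} (hχ : Continuous χ)
    (hχ0 : ∀ η, 0 ≤ χ η) (hχ1 : ∀ η, η ≠ 0 → ∫ τ : ℝ, χ (Real.exp (-τ) • η) = 1)
    {c : W → ℂ} (hc : Integrable c) {F : E3 → ℂ} (hF : Integrable F) :
    Integrable (fun p : (W × ℝ) × E3 => c p.1.1 * (χ (Real.exp (-p.1.2) • p.2) : ℂ) * F p.2)
      ((volume.prod volume).prod volume) := by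
  have hi : ∀ η, η ≠ 0 → Integrable fun τ : ℝ => χ (Real.exp (-τ) • η) := by
    intro η hη
    by_contra h
    have := hχ1 η hη
    rw [integral_undef h] at this
    exact zero_ne_one this
  have hae : ∀ᵐ η : E3, η ≠ 0 := by simp [ae_iff]
  rw [integrable_prod_iff']
  · constructor
    · filter_upwards [hae] with η hη
      exact (hc.mul_prod (hi η hη).ofReal).mul_const _
    · refine (hF.norm.const_mul (∫ w, ‖c w‖)).congr ?_
      filter_upwards [hae] with η hη
      simp_rw [norm_mul, integral_mul_const]
      rw [integral_prod_mul (fun w => ‖c w‖) (fun τ : ℝ => ‖(χ (Real.exp (-τ) • η) : ℂ)‖)]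
      simp_rw [Complex.norm_real, Real.norm_of_nonneg (hχ0 _), hχ1 η hη, mul_one]
  · refine (AEStronglyMeasurable.mul ?_ ?_).mul ?_
    · exact hc.aestronglyMeasurable.comp_fst.comp_fst
    · have h : Continuous fun q : ℝ × E3 => (χ (Real.exp (-q.1) • q.2) : ℂ) := by fun_prop
      exact (h.measurable.comp (measurable_fst.snd.prodMk measurable_snd)).aestronglyMeasurable
    · exact hF.aestronglyMeasurable.comp_snd

end Piece

section PieceBound

/-- The symbol `N` satisfies, on the frequency side, the bilinear `L²` estimate in which the first
function is measured in `W^{1,M}` and the second in `H^σ`. -/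
def IsHighLowBounded (σ M : ℝ) (N : E3 → E3 → ℂ) : Prop :=
    ∃ C : ℝ, 0 ≤ C ∧ ∀ f g : SchwartzMap E3 ℂ,
      (∀ ξ, ξ ≠ 0 → Integrable fun η => N ξ η * 𝓕 (f : E3 → ℂ) η * 𝓕 (g : E3 → ℂ) (ξ - η)) ∧
      AEStronglyMeasurable
        (fun ξ => ∫ η, N ξ η * 𝓕 (f : E3 → ℂ) η * 𝓕 (g : E3 → ℂ) (ξ - η)) volume ∧
      eLpNorm (fun ξ => ∫ η, N ξ η * 𝓕 (f : E3 → ℂ) η * 𝓕 (g : E3 → ℂ) (ξ - η)) 2 volume ≤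
        ENNReal.ofReal C * (sobolevW1 M f * sobolevH σ g)

/-- The frequency-side integrand obtained by expanding a localized symbol into characters at each
dyadic scale `exp τ`. -/
noncomputable def pieceKernel {W : Type*} (σ : ℝ) (χ : E3 → ℝ) (R : E3 → ℂ) (P₁ P₂ : E3 → ℝ × E3)
    (c : W → ℂ) (ℓ : W → ℝ × E3 → ℝ) (Y : W → E3) (F H : E3 → ℂ) (ω : W × ℝ) (ξ η : E3) : ℂ :=
  c ω.1 * (Real.fourierChar (ℓ ω.1 (P₁ (Real.exp (-ω.2) • ξ))) : ℂ) *
    (((χ (Real.exp (-ω.2) • η) : ℂ) *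
        (Real.fourierChar ⟪Y ω.1, Real.exp (-ω.2) • η⟫_ℝ : ℂ) * F η) *
      (((Real.exp ω.2 ^ σ : ℝ) : ℂ) * R (Real.exp (-ω.2) • (ξ - η)) *
        (Real.fourierChar (ℓ ω.1 (P₂ (Real.exp (-ω.2) • (ξ - η)))) : ℂ) * H (ξ - η)))

theorem measurable_coe_fourierChar : Measurable fun t : ℝ => (Real.fourierChar t : ℂ) :=
  (contDiff_fourierChar (n := 0)).continuous.measurable

variable {n : ℕ} {σ : ℝ} {χ : E3 → ℝ} {R : E3 → ℂ} {P₁ P₂ : E3 → ℝ × E3}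
  {c : EuclideanSpace ℝ (Fin n) → ℂ} {ℓ : EuclideanSpace ℝ (Fin n) → ℝ × E3 → ℝ}
  {Y : EuclideanSpace ℝ (Fin n) → E3} {F H : E3 → ℂ}

theorem measurable_pieceKernel (hχ : Continuous χ) (hR : Measurable R) (hP₁ : Measurable P₁)
    (hP₂ : Measurable P₂) (hc : Continuous c) (hℓ : Continuous (Function.uncurry ℓ))
    (hY : Continuous Y) (hF : Continuous F) (hH : Continuous H) :
    Measurable fun p : ((EuclideanSpace ℝ (Fin n) × ℝ) × E3) × E3 =>
      pieceKernel σ χ R P₁ P₂ c ℓ Y F H p.1.1 p.1.2 p.2 := by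
  unfold pieceKernel
  have he := measurable_coe_fourierChar
  have hℓ' := hℓ.measurable
  have hχ' := hχ.measurable
  have hc' := hc.measurable
  have hY' := hY.measurable
  have hF' := hF.measurable
  have hH' := hH.measurable
  have e : ∀ P : E3 → ℝ × E3, Measurable P → ∀ u : ((EuclideanSpace ℝ (Fin n) × ℝ) × E3) × E3 → E3,
      Measurable u → Measurable fun p : ((EuclideanSpace ℝ (Fin n) × ℝ) × E3) × E3 =>
        (Real.fourierChar (ℓ p.1.1.1 (P (u p))) : ℂ) := fun P hP u hu =>
    he.comp (hℓ'.comp (measurable_fst.fst.fst.prodMk (hP.comp hu)))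
  refine ((hc'.comp measurable_fst.fst.fst).mul (e _ hP₁ _ (by fun_prop))).mul
    (((Measurable.mul (by fun_prop) (he.comp ?_)).mul (by fun_prop)).mul
    (((Measurable.mul (by fun_prop) (hR.comp (by fun_prop))).mul (e _ hP₂ _ (by fun_prop))).mul
      (by fun_prop)))
  fun_prop

theorem norm_mul_rpow_dilate_le {C₀ : ℝ} (hRC : ∀ ζ, ‖R ζ‖ ≤ C₀ * ‖ζ‖ ^ σ) (τ : ℝ) (ζ : E3) :
    ‖((Real.exp τ ^ σ : ℝ) : ℂ) * R (Real.exp (-τ) • ζ)‖ ≤ C₀ * ‖ζ‖ ^ σ := by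
  rw [norm_mul, Complex.norm_real, Real.norm_of_nonneg (by positivity)]
  calc _ ≤ Real.exp τ ^ σ * (C₀ * ‖Real.exp (-τ) • ζ‖ ^ σ) := by gcongr; exact hRC _
    _ = (Real.exp τ * Real.exp (-τ)) ^ σ * (C₀ * ‖ζ‖ ^ σ) := by
      rw [norm_smul, Real.norm_of_nonneg (Real.exp_pos _).le, Real.mul_rpow (by positivity)
        (norm_nonneg _), Real.mul_rpow (by positivity) (by positivity)]
      ring
    _ = _ := by rw [← Real.exp_add]; simp

theorem norm_pieceKernel_le {C₀ : ℝ} (hRC : ∀ ζ, ‖R ζ‖ ≤ C₀ * ‖ζ‖ ^ σ)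
    {B : ℝ} (hB : ∀ ζ, C₀ * ‖ζ‖ ^ σ * ‖H ζ‖ ≤ B) (ω : EuclideanSpace ℝ (Fin n) × ℝ) (ξ η : E3) :
    ‖pieceKernel σ χ R P₁ P₂ c ℓ Y F H ω ξ η‖ ≤
      B * ‖c ω.1 * (χ (Real.exp (-ω.2) • η) : ℂ) * F η‖ := by
  have h := norm_mul_rpow_dilate_le hRC ω.2 (ξ - η)
  unfold pieceKernel
  rw [norm_mul, norm_mul, norm_mul, norm_mul, norm_mul, norm_mul (_ * R _ * _) (H _),
    norm_mul (_ * R _) _]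
  simp only [Circle.norm_coe, mul_one]
  calc _ ≤ ‖c ω.1‖ * (‖(χ (Real.exp (-ω.2) • η) : ℂ)‖ * ‖F η‖ *
        (C₀ * ‖ξ - η‖ ^ σ * ‖H (ξ - η)‖)) := by gcongr
    _ ≤ ‖c ω.1‖ * (‖(χ (Real.exp (-ω.2) • η) : ℂ)‖ * ‖F η‖ * B) := by gcongr; exact hB _
    _ = _ := by rw [norm_mul, norm_mul]; ring

theorem integrable_pieceKernel (hχ : Continuous χ) (hR : Measurable R) (hP₁ : Measurable P₁)
    (hP₂ : Measurable P₂) (hc : Continuous c) (hℓ : Continuous (Function.uncurry ℓ))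
    (hY : Continuous Y) (hF : Continuous F) (hH : Continuous H)
    (hχ0 : ∀ η, 0 ≤ χ η) (hχ1 : ∀ η, η ≠ 0 → ∫ τ : ℝ, χ (Real.exp (-τ) • η) = 1)
    (hci : Integrable c) (hFi : Integrable F)
    {C₀ : ℝ} (hRC : ∀ ζ, ‖R ζ‖ ≤ C₀ * ‖ζ‖ ^ σ)
    {B : ℝ} (hB : ∀ ζ, C₀ * ‖ζ‖ ^ σ * ‖H ζ‖ ≤ B) (ξ : E3) :
    Integrable (fun p : (EuclideanSpace ℝ (Fin n) × ℝ) × E3 =>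
      pieceKernel σ χ R P₁ P₂ c ℓ Y F H p.1 ξ p.2) ((volume.prod volume).prod volume) := by
  have h := (integrable_dilate_mul hχ hχ0 hχ1 hci hFi).norm.const_mul B
  refine h.mono' ?_ (.of_forall fun p => norm_pieceKernel_le hRC hB _ _ _)
  exact ((measurable_pieceKernel hχ hR hP₁ hP₂ hc hℓ hY hF hH).comp
    (measurable_fst.prodMk measurable_const |>.prodMk measurable_snd)).aestronglyMeasurable

theorem integral_pieceKernel {G : (ℝ × E3) × E3 → ℂ} {N : E3 → E3 → ℂ}
    (hχ1 : ∀ η, η ≠ 0 → ∫ τ : ℝ, χ (Real.exp (-τ) • η) = 1)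
    (hℓ : ∀ w p q, ℓ w (p + q) = ℓ w p + ℓ w q)
    (hG : ∀ p v, G (p, v) =
        ∫ w, c w * ((Real.fourierChar (ℓ w p) : ℂ) * (Real.fourierChar ⟪Y w, v⟫_ℝ : ℂ)))
    (hN : ∀ ξ η : E3, ξ ≠ 0 → η ≠ 0 → ξ ≠ η → ∀ r : ℝ, 0 < r →
      N (r • ξ) (r • η) = ((r ^ σ : ℝ) : ℂ) * N ξ η)
    (hNG : ∀ ξ η : E3, ξ ≠ 0 → η ≠ 0 → ξ ≠ η → χ η ≠ 0 →
      N ξ η = R (ξ - η) * G (P₁ ξ + P₂ (ξ - η), η))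
    {ξ η : E3} (hξ : ξ ≠ 0) (hη : η ≠ 0) (hξη : ξ ≠ η)
    (hi : Integrable (fun ω => pieceKernel σ χ R P₁ P₂ c ℓ Y F H ω ξ η) (volume.prod volume)) :
    ∫ ω, pieceKernel σ χ R P₁ P₂ c ℓ Y F H ω ξ η ∂(volume.prod volume) =
      N ξ η * F η * H (ξ - η) := by
  rw [integral_prod_symm _ hi]
  have key : ∀ τ : ℝ, ∫ w, pieceKernel σ χ R P₁ P₂ c ℓ Y F H (w, τ) ξ η =
      (χ (Real.exp (-τ) • η) : ℂ) * (N ξ η * F η * H (ξ - η)) := by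
    intro τ
    set r := Real.exp (-τ) with hr
    have hr0 : 0 < r := Real.exp_pos _
    have e1 : ∫ w, pieceKernel σ χ R P₁ P₂ c ℓ Y F H (w, τ) ξ η =
        (χ (r • η) : ℂ) * F η * H (ξ - η) * ((Real.exp τ ^ σ : ℝ) : ℂ) *
          (R (r • (ξ - η)) * G (P₁ (r • ξ) + P₂ (r • (ξ - η)), r • η)) := by
      rw [hG, ← integral_const_mul, ← integral_const_mul]
      congr with w
      rw [hℓ, AddChar.map_add_eq_mul, Circle.coe_mul]
      simp only [pieceKernel, ← hr]
      ring
    rw [e1]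
    by_cases h0 : χ (r • η) = 0
    · simp [h0]
    · have h1 := hNG (r • ξ) (r • η) (smul_ne_zero hr0.ne' hξ) (smul_ne_zero hr0.ne' hη)
        (fun h => hξη (smul_right_injective _ hr0.ne' h)) h0
      rw [← smul_sub] at h1
      have h2 : ((Real.exp τ ^ σ : ℝ) : ℂ) * ((r ^ σ : ℝ) : ℂ) = 1 := by
        rw [← Complex.ofReal_mul, ← Real.mul_rpow (by positivity) hr0.le, hr, ← Real.exp_add]
        simp
      rw [← h1, hN ξ η hξ hη hξη r hr0]
      linear_combination (χ (r • η) : ℂ) * F η * H (ξ - η) * N ξ η * h2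
  simp_rw [key]
  rw [integral_mul_const, integral_complex_ofReal, hχ1 η hη]
  simp

theorem sobolevW1_lt_top {M : ℝ} (f : SchwartzMap E3 ℂ) : sobolevW1 M f < ∞ :=
  ENNReal.add_lt_top.2 ⟨(f.memLp _ volume).2,
    ((SchwartzMap.fderivCLM ℝ E3 ℂ f).memLp (ENNReal.ofReal M) volume).2⟩

theorem exists_piece_bound (hσ : 0 ≤ σ) {M : ℝ} (hM : 3 < M)
    (hχ : ContDiff ℝ (⊤ : ℕ∞) χ) (hχc : HasCompactSupport χ) (hχz : χ =ᶠ[nhds 0] 0)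
    (hχ0 : ∀ η, 0 ≤ χ η) (hχ1 : ∀ η, η ≠ 0 → ∫ τ : ℝ, χ (Real.exp (-τ) • η) = 1)
    {G : (ℝ × E3) × E3 → ℂ} (hG : ContDiff ℝ (⊤ : ℕ∞) G) (hGc : HasCompactSupport G)
    (hP₁ : Measurable P₁) (hP₂ : Measurable P₂) (hR : Measurable R)
    {C₀ : ℝ} (hC₀ : 0 ≤ C₀) (hRC : ∀ ζ, ‖R ζ‖ ≤ C₀ * ‖ζ‖ ^ σ) {N : E3 → E3 → ℂ}
    (hN : ∀ ξ η : E3, ξ ≠ 0 → η ≠ 0 → ξ ≠ η → ∀ r : ℝ, 0 < r →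
      N (r • ξ) (r • η) = ((r ^ σ : ℝ) : ℂ) * N ξ η)
    (hNG : ∀ ξ η : E3, ξ ≠ 0 → η ≠ 0 → ξ ≠ η → χ η ≠ 0 →
      N ξ η = R (ξ - η) * G (P₁ ξ + P₂ (ξ - η), η)) :
    IsHighLowBounded σ M N := by
  obtain ⟨n, c, ℓ, Y, hc, hci, hℓ, hY, hadd, hrep⟩ := exists_tensor_characters hG hGc
  have hχC : ContDiff ℝ (⊤ : ℕ∞) fun η => (χ η : ℂ) := Complex.ofRealCLM.contDiff.comp hχ
  have hχCc : HasCompactSupport fun η => (χ η : ℂ) := hχc.comp_left (g := Complex.ofReal) rfl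
  have hχCz : (fun η => (χ η : ℂ)) =ᶠ[nhds 0] 0 := by
    filter_upwards [hχz] with η h
    simp [h]
  obtain ⟨C₁, hC₁, hW⟩ := exists_enorm_fourierInv_dilate_le_sobolevW1 hχC hχCc hχCz
    (M := M) (by linarith)
  set Q : ℝ≥0∞ := (∫⁻ w, ‖c w‖ₑ) * (∫⁻ τ : ℝ, ENNReal.ofReal
    (C₁ * min (Real.exp (3 * τ / M)) (Real.exp (-(1 - 3 / M) * τ)))) * ENNReal.ofReal C₀ with hQ
  have hQt : Q ≠ ∞ := ENNReal.mul_ne_top (ENNReal.mul_ne_top hci.2.ne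
    (lintegral_min_exp_lt_top hM C₁).ne) ENNReal.ofReal_ne_top
  refine ⟨Q.toReal, ENNReal.toReal_nonneg, fun f g => ?_⟩
  rw [ENNReal.ofReal_toReal hQt]
  have hF : Continuous (𝓕 (f : E3 → ℂ)) := by
    rw [← SchwartzMap.fourier_coe]; exact SchwartzMap.continuous _
  have hH : Continuous (𝓕 (g : E3 → ℂ)) := by
    rw [← SchwartzMap.fourier_coe]; exact SchwartzMap.continuous _
  have hFi : Integrable (𝓕 (f : E3 → ℂ)) := by
    rw [← SchwartzMap.fourier_coe]; exact SchwartzMap.integrable _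
  obtain ⟨B, hB⟩ : ∃ B, ∀ ζ, C₀ * ‖ζ‖ ^ σ * ‖𝓕 (g : E3 → ℂ) ζ‖ ≤ B := by
    obtain ⟨h, hh⟩ := exists_schwartz_norm_eq σ g
    obtain ⟨B, -, hB⟩ := h.decay 0 0
    refine ⟨C₀ * B, fun ζ => ?_⟩
    have := hB ζ
    simp only [pow_zero, one_mul, norm_iteratedFDeriv_zero, hh] at this
    rw [mul_assoc]
    refine mul_le_mul_of_nonneg_left (le_trans ?_ this) hC₀
    gcongr
    simpa using rpow_norm_le hσ le_rfl ζ
  let K := pieceKernel σ χ R P₁ P₂ c ℓ Y (𝓕 (f : E3 → ℂ)) (𝓕 (g : E3 → ℂ))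
  have hKi : ∀ ξ, Integrable (fun p : (EuclideanSpace ℝ (Fin n) × ℝ) × E3 => K p.1 ξ p.2)
      ((volume.prod volume).prod volume) :=
    integrable_pieceKernel hχ.continuous hR hP₁ hP₂ hc hℓ hY hF hH hχ0 hχ1 hci hFi hRC hB
  have hae : ∀ ξ, ξ ≠ 0 → (fun η => ∫ ω, K ω ξ η ∂(volume.prod volume)) =ᵐ[volume]
      fun η => N ξ η * 𝓕 (f : E3 → ℂ) η * 𝓕 (g : E3 → ℂ) (ξ - η) := by
    intro ξ hξ
    have h0 : ∀ᵐ η : E3, η ≠ 0 := by simp [ae_iff]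
    have h1 : ∀ᵐ η : E3, ξ ≠ η := by simp [ae_iff]
    filter_upwards [h0, h1, (hKi ξ).prod_left_ae] with η h0 h1 h2
    exact integral_pieceKernel hχ1 hadd hrep hN hNG hξ h0 h1 h2
  refine ⟨fun ξ hξ => (hKi ξ).integral_prod_right.congr (hae ξ hξ), ?_⟩
  have hswap : (fun ξ => ∫ η, N ξ η * 𝓕 (f : E3 → ℂ) η * 𝓕 (g : E3 → ℂ) (ξ - η)) =ᵐ[volume]
      fun ξ => ∫ ω, ∫ η, K ω ξ η ∂volume ∂(volume.prod volume) := by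
    have h0 : ∀ᵐ ξ : E3, ξ ≠ 0 := by simp [ae_iff]
    filter_upwards [h0] with ξ hξ
    rw [integral_integral_swap (hKi ξ)]
    exact integral_congr_ae (hae ξ hξ).symm
  have hKm := measurable_pieceKernel (σ := σ) hχ.continuous hR hP₁ hP₂ hc hℓ hY hF hH
  have hΦm : Measurable (Function.uncurry fun (ω : EuclideanSpace ℝ (Fin n) × ℝ) ξ =>
      ∫ η, K ω ξ η) := by
    have := (hKm.stronglyMeasurable.integral_prod_right' (ν := volume)).measurable
    exact this
  refine ⟨(hΦm.stronglyMeasurable.integral_prod_left'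
    (μ := volume.prod volume)).aestronglyMeasurable.congr hswap.symm, ?_⟩
  rw [eLpNorm_congr_ae hswap]
  refine (eLpNorm_integral_le_lintegral_eLpNorm hΦm).trans ?_
  have hω : ∀ ω : EuclideanSpace ℝ (Fin n) × ℝ, eLpNorm (fun ξ => ∫ η, K ω ξ η) 2 volume ≤
      ‖c ω.1‖ₑ * ENNReal.ofReal (C₁ * min (Real.exp (3 * ω.2 / M))
        (Real.exp (-(1 - 3 / M) * ω.2))) * (ENNReal.ofReal C₀ * (sobolevW1 M f * sobolevH σ g)) := by
    rintro ⟨w, τ⟩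
    obtain ⟨a, ha, haF⟩ := exists_schwartz_modulated_dilate hχC hχCc f (Real.exp (-τ))
      (Real.exp_pos _).ne' (Y w)
    set b : E3 → ℂ := fun ζ => ((Real.exp τ ^ σ : ℝ) : ℂ) * R (Real.exp (-τ) • ζ) *
        (Real.fourierChar (ℓ w (P₂ (Real.exp (-τ) • ζ))) : ℂ) * 𝓕 (g : E3 → ℂ) ζ with hb
    have hbm : Measurable b := by
      have h1 : Measurable fun ζ : E3 => R (Real.exp (-τ) • ζ) := hR.comp (measurable_const_smul _)
      have h2 : Measurable fun ζ : E3 => (Real.fourierChar (ℓ w (P₂ (Real.exp (-τ) • ζ))) : ℂ) :=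
        measurable_coe_fourierChar.comp (hℓ.measurable.comp
          (measurable_const.prodMk (hP₂.comp (measurable_const_smul _))))
      exact ((measurable_const.mul h1).mul h2).mul hH.measurable
    obtain ⟨hb2, hbn⟩ := memLp_of_norm_le_rpow_mul_fourier hσ g hbm hC₀ (fun ζ => by
      rw [hb, norm_mul, norm_mul, Circle.norm_coe, mul_one, ← mul_assoc]
      gcongr
      exact norm_mul_rpow_dilate_le hRC τ ζ)
    have hD : ∀ x, ‖𝓕⁻ (a : E3 → ℂ) x‖ ≤ (ENNReal.ofReal (C₁ * min (Real.exp (3 * τ / M))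
        (Real.exp (-(1 - 3 / M) * τ))) * sobolevW1 M f).toReal := by
      intro x
      rw [haF, ← toReal_enorm]
      exact ENNReal.toReal_mono (ENNReal.mul_ne_top ENNReal.ofReal_ne_top (sobolevW1_lt_top f).ne)
        (hW f τ _)
    have hconv := eLpNorm_convolution_le a hb2 hD
    rw [ENNReal.ofReal_toReal
      (ENNReal.mul_ne_top ENNReal.ofReal_ne_top (sobolevW1_lt_top f).ne)] at hconv
    have hΦ : ∀ ξ, ‖∫ η, K (w, τ) ξ η‖ ≤ ‖c w‖ * ‖∫ η, a η * b (ξ - η)‖ := by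
      intro ξ
      have : ∫ η, K (w, τ) ξ η = c w *
          (Real.fourierChar (ℓ w (P₁ (Real.exp (-τ) • ξ))) : ℂ) * ∫ η, a η * b (ξ - η) := by
        rw [← integral_const_mul]
        congr with η
        rw [ha]
        rfl
      rw [this, norm_mul, norm_mul, Circle.norm_coe, mul_one]
    refine (eLpNorm_le_mul_eLpNorm_of_ae_le_mul (.of_forall hΦ) 2).trans ?_
    rw [ofReal_norm]
    calc _ ≤ ‖c w‖ₑ * (ENNReal.ofReal (C₁ * min (Real.exp (3 * τ / M))
        (Real.exp (-(1 - 3 / M) * τ))) * sobolevW1 M f * (ENNReal.ofReal C₀ * sobolevH σ g)) := by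
          gcongr
          exact hconv.trans (by gcongr)
      _ = _ := by ring
  refine (lintegral_mono hω).trans ?_
  have hc' := hc.measurable
  have hm1 : AEMeasurable (fun w => ‖c w‖ₑ) := hc.measurable.enorm.aemeasurable
  have hm2 : Measurable fun τ : ℝ => ENNReal.ofReal (C₁ * min (Real.exp (3 * τ / M))
        (Real.exp (-(1 - 3 / M) * τ))) := by fun_prop
  rw [lintegral_mul_const _ (by fun_prop), lintegral_prod_mul hm1 hm2.aemeasurable, hQ]
  apply le_of_eq
  ring

end PieceBound

section Cutoffs

theorem exists_logarithmic_partition : ∃ χ : E3 → ℝ, ContDiff ℝ (⊤ : ℕ∞) χ ∧ HasCompactSupport χ ∧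
    χ =ᶠ[nhds 0] 0 ∧ (∀ η, 0 ≤ χ η) ∧ (∀ η, η ≠ 0 → ∫ τ : ℝ, χ (Real.exp (-τ) • η) = 1) ∧
    ∀ η, χ η ≠ 0 → 1 ≤ ‖η‖ ∧ ‖η‖ ≤ 2 := by
  let B : ContDiffBump (1 / 3 : ℝ) := ⟨1 / 8, 1 / 4, by norm_num, by norm_num⟩
  let b : ℝ → ℝ := B.normed volume
  have hb : ContDiff ℝ (⊤ : ℕ∞) b := B.contDiff_normed
  have hb0 : ∀ t, b t ≠ 0 → 0 < t ∧ t < 7 / 12 := by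
    intro t ht
    have : t ∈ Function.support b := ht
    rw [B.support_normed_eq, Real.ball_eq_Ioo] at this
    obtain ⟨h1, h2⟩ := this
    simp only [B] at h1 h2
    constructor <;> linarith
  have hsupp : ∀ η : E3, b (Real.log ‖η‖) ≠ 0 → 1 ≤ ‖η‖ ∧ ‖η‖ ≤ 2 := by
    intro η h
    obtain ⟨h1, h2⟩ := hb0 _ h
    have hpos : 0 < ‖η‖ := by
      rcases (norm_nonneg η).eq_or_lt with h0 | h0
      · rw [← h0] at h1
        simp at h1
      · exact h0
    refine ⟨((Real.log_pos_iff (norm_nonneg _)).1 h1).le, ?_⟩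
    rw [← Real.log_le_log_iff hpos (by norm_num)]
    have := Real.log_two_gt_d9
    linarith
  have hzero : (fun η : E3 => b (Real.log ‖η‖)) =ᶠ[nhds 0] 0 := by
    filter_upwards [Metric.ball_mem_nhds (0 : E3) one_pos] with η hη
    by_contra h
    have := (hsupp η h).1
    rw [mem_ball_zero_iff] at hη
    linarith
  refine ⟨fun η => b (Real.log ‖η‖), ?_, ?_, hzero, fun η => B.nonneg_normed _, ?_, hsupp⟩
  · rw [contDiff_iff_contDiffAt]
    intro η
    by_cases hη : η = 0
    · subst hη
      exact (contDiffAt_const (c := (0 : ℝ))).congr_of_eventuallyEq hzero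
    · exact hb.contDiffAt.comp η ((contDiffAt_norm ℝ hη).log (norm_ne_zero_iff.2 hη))
  · refine HasCompactSupport.intro (isCompact_closedBall (0 : E3) 2) fun η hη => ?_
    by_contra h
    exact hη (mem_closedBall_zero_iff.2 (hsupp η h).2)
  · intro η hη
    have : ∀ τ : ℝ, Real.log ‖Real.exp (-τ) • η‖ = Real.log ‖η‖ - τ := by
      intro τ
      rw [norm_smul, Real.norm_of_nonneg (Real.exp_pos _).le,
        Real.log_mul (Real.exp_pos _).ne' (norm_ne_zero_iff.2 hη), Real.log_exp]
      ring
    simp_rw [this]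
    rw [integral_sub_left_eq_self b volume (Real.log ‖η‖)]
    exact B.integral_normed

/-- A smooth cutoff of the annulus `1 / 4 ≤ ‖x‖ ^ 2 ≤ 4`. -/
theorem exists_annular_cutoff : ∃ θ : E3 → ℝ, ContDiff ℝ (⊤ : ℕ∞) θ ∧
    (∀ x, 1 ≤ ‖x‖ → ‖x‖ ≤ 2 → θ x = 1) ∧ ∀ x, θ x ≠ 0 → 1 / 8 ≤ ‖x‖ ^ 2 ∧ ‖x‖ ^ 2 ≤ 5 := by
  let B : ContDiffBump (17 / 8 : ℝ) := ⟨15 / 8, 2, by norm_num, by norm_num⟩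
  refine ⟨fun x => B (‖x‖ ^ 2), B.contDiff.comp (contDiff_norm_sq ℝ), fun x h1 h2 => ?_,
    fun x hx => ?_⟩
  · apply B.one_of_mem_closedBall
    rw [Real.closedBall_eq_Icc]
    simp only [B]
    constructor <;> nlinarith
  · have : ‖x‖ ^ 2 ∈ Function.support B := hx
    rw [B.support_eq, Real.ball_eq_Ioo] at this
    obtain ⟨h1, h2⟩ := this
    simp only [B] at h1 h2
    constructor <;> linarith

/-- A smooth degree-zero homogeneous cutoff of the region `a ≪ b`. -/
noncomputable def ratioCutoff (e a b : ℝ) : ℝ :=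
  Real.smoothTransition (2 / e * ((e * b - a) / (a + b)))

variable {e a b : ℝ}

theorem ratioCutoff_smul {l : ℝ} (hl : l ≠ 0) :
    ratioCutoff e (l * a) (l * b) = ratioCutoff e a b := by
  unfold ratioCutoff
  rw [show e * (l * b) - l * a = l * (e * b - a) by ring, ← mul_add, mul_div_mul_left _ _ hl]

theorem ratioCutoff_eq_zero (he : 0 < e) (ha : 0 ≤ a) (hb : 0 ≤ b) (h : e * b ≤ a) :
    ratioCutoff e a b = 0 := by
  apply Real.smoothTransition.zero_of_nonpos
  apply mul_nonpos_of_nonneg_of_nonpos (by positivity)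
  exact div_nonpos_of_nonpos_of_nonneg (by linarith) (by positivity)

theorem ratioCutoff_eq_one (he : 0 < e) (he1 : e ≤ 1) (ha : 0 ≤ a) (hb : 0 < b) (h : a ≤ e / 3 * b) :
    ratioCutoff e a b = 1 := by
  apply Real.smoothTransition.one_of_one_le
  rw [← mul_div_assoc, one_le_div (by positivity), div_mul_eq_mul_div, le_div_iff₀ he]
  nlinarith

theorem contDiffAt_ratioCutoff {X : Type*} [NormedAddCommGroup X] [NormedSpace ℝ X] {u v : X → ℝ}
    {x : X} (hu : ContDiffAt ℝ (⊤ : ℕ∞) u x) (hv : ContDiffAt ℝ (⊤ : ℕ∞) v x)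
    (h : u x + v x ≠ 0) : ContDiffAt ℝ (⊤ : ℕ∞) (fun y => ratioCutoff e (u y) (v y)) x := by
  unfold ratioCutoff
  apply Real.smoothTransition.contDiff.contDiffAt.comp
  exact contDiffAt_const.mul (((contDiffAt_const.mul hv).sub hu).div (hu.add hv) h)

theorem contDiff_and_hasCompactSupport_of_isCompact {X : Type*} [NormedAddCommGroup X]
    [NormedSpace ℝ X] {F : X → ℂ} {K : Set X} (hK : IsCompact K) (h0 : ∀ x, x ∉ K → F x = 0)
    (hF : ∀ x ∈ K, ContDiffAt ℝ (⊤ : ℕ∞) F x) :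
    ContDiff ℝ (⊤ : ℕ∞) F ∧ HasCompactSupport F := by
  refine ⟨contDiff_iff_contDiffAt.2 fun x => ?_, HasCompactSupport.intro hK h0⟩
  by_cases hx : x ∈ K
  · exact hF x hx
  · refine (contDiffAt_const (c := (0 : ℂ))).congr_of_eventuallyEq ?_
    filter_upwards [hK.isClosed.isOpen_compl.mem_nhds hx] with y hy
    exact h0 y hy

/-- Conditions cutting out a compact set of parameters. -/
theorem isCompact_of_isClosed_of_norm_le {K : Set ((ℝ × E3) × E3)} (hK : IsClosed K) {A : ℝ}
    (h : ∀ p ∈ K, ‖p.1.1‖ ≤ A ∧ ‖p.1.2‖ ≤ A ∧ ‖p.2‖ ≤ A) : IsCompact K := by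
  refine Metric.isCompact_of_isClosed_isBounded hK ?_
  refine (Metric.isBounded_closedBall (x := (0 : (ℝ × E3) × E3)) (r := A)).subset fun p hp => ?_
  obtain ⟨h1, h2, h3⟩ := h p hp
  rw [mem_closedBall_zero_iff, Prod.norm_def, Prod.norm_def]
  exact max_le (max_le h1 h2) h3

end Cutoffs

section LocalizedSymbols

variable {s : ℝ} {k : ℕ} {M : ℝ} {m : E3 → E3 → ℂ} {e : ℝ}

theorem localized_symbol_smul
    (hhom : ∀ l : ℝ, 0 < l → ∀ ξ η : E3, m (l • ξ) (l • η) = ((l ^ s : ℝ) : ℂ) * m ξ η)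
    {κ : E3 → E3 → ℝ} (hκ : ∀ ξ η : E3, ∀ l : ℝ, 0 < l → κ (l • ξ) (l • η) = κ ξ η) (ξ η : E3)
    {l : ℝ} (hl : 0 < l) :
    ((‖l • ξ‖ ^ k : ℝ) : ℂ) * m (l • ξ) (l • η) * (κ (l • ξ) (l • η) : ℂ) =
      ((l ^ (s + k) : ℝ) : ℂ) * (((‖ξ‖ ^ k : ℝ) : ℂ) * m ξ η * (κ ξ η : ℂ)) := by
  rw [hhom l hl, hκ ξ η l hl, norm_smul, Real.norm_of_nonneg hl.le, Real.rpow_add hl,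
    Real.rpow_natCast, mul_pow]
  push_cast
  ring

theorem ratioCutoff_norm_smul (u v : E3) {l : ℝ} (hl : 0 < l) :
    ratioCutoff e (‖l • u‖ ^ 2) (‖l • v‖ ^ 2) = ratioCutoff e (‖u‖ ^ 2) (‖v‖ ^ 2) := by
  rw [norm_smul, norm_smul, mul_pow, mul_pow]
  exact ratioCutoff_smul (pow_ne_zero 2 (norm_ne_zero_iff.2 hl.ne'))

theorem norm_sq_lt_of_ratioCutoff_ne_zero (he : 0 < e) {u v : E3}
    (h : ratioCutoff e (‖u‖ ^ 2) (‖v‖ ^ 2) ≠ 0) : ‖u‖ ^ 2 < e * ‖v‖ ^ 2 := by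
  by_contra! h'
  exact h (ratioCutoff_eq_zero he (by positivity) (by positivity) h')

theorem isHighLowBounded_of_low_frequency (hs : 0 ≤ s) (hM : 3 < M)
    (hhom : ∀ l : ℝ, 0 < l → ∀ ξ η : E3, m (l • ξ) (l • η) = ((l ^ s : ℝ) : ℂ) * m ξ η)
    {δ : ℝ} (hδ : 0 < δ) {A : ℝ × E3 × E3 → ℂ} (hA : ContDiff ℝ (⊤ : ℕ∞) A)
    (hmA : ∀ ξ η : E3, 0 < ‖η‖ → ‖η‖ ≤ δ → 1 / 2 ≤ ‖ξ - η‖ → ‖ξ - η‖ ≤ 2 →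
      m ξ η = A (‖η‖, ‖η‖⁻¹ • η, ξ - η))
    (he : 0 < e) (he1 : e ≤ 1 / 16) (heδ : 4 * e ≤ δ ^ 2) :
    IsHighLowBounded (s + k) M fun ξ η =>
      ((‖ξ‖ ^ k : ℝ) : ℂ) * m ξ η * (ratioCutoff e (‖η‖ ^ 2) (‖ξ - η‖ ^ 2) : ℂ) := by
  obtain ⟨χ, hχ, hχc, hχz, hχ0, hχ1, hχs⟩ := exists_logarithmic_partition
  obtain ⟨θ, hθ, hθ1, hθs⟩ := exists_annular_cutoff
  let G : (ℝ × E3) × E3 → ℂ := fun p => ((‖p.1.2 + p.1.1 • p.2‖ ^ k : ℝ) : ℂ) *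
    A (p.1.1 * ‖p.2‖, ‖p.2‖⁻¹ • p.2, p.1.2) *
      ((ratioCutoff e (p.1.1 ^ 2 * ‖p.2‖ ^ 2) 1 * θ p.2 * θ p.1.2 : ℝ) : ℂ)
  let K : Set ((ℝ × E3) × E3) := {p | 1 / 8 ≤ ‖p.1.2‖ ^ 2 ∧ ‖p.1.2‖ ^ 2 ≤ 5 ∧ 1 / 8 ≤ ‖p.2‖ ^ 2 ∧
    ‖p.2‖ ^ 2 ≤ 5 ∧ p.1.1 ^ 2 * ‖p.2‖ ^ 2 ≤ e}
  have hKc : IsClosed K := by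
    refine IsClosed.and ?_ (IsClosed.and ?_ (IsClosed.and ?_ (IsClosed.and ?_ ?_))) <;>
      exact isClosed_le (by fun_prop) (by fun_prop)
  have hK : IsCompact K := by
    refine isCompact_of_isClosed_of_norm_le hKc (A := 3) fun p hp => ?_
    obtain ⟨h1, h2, h3, h4, h5⟩ := hp
    refine ⟨?_, ?_, ?_⟩
    · rw [Real.norm_eq_abs]
      apply abs_le_of_sq_le_sq _ (by norm_num)
      nlinarith [sq_nonneg p.1.1]
    · nlinarith [norm_nonneg p.1.2]
    · nlinarith [norm_nonneg p.2]
  have hG0 : ∀ p, p ∉ K → G p = 0 := by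
    intro p hp
    by_contra h
    refine hp ?_
    have h' : ratioCutoff e (p.1.1 ^ 2 * ‖p.2‖ ^ 2) 1 * θ p.2 * θ p.1.2 ≠ 0 := by
      intro h0
      apply h
      simp only [G]
      rw [h0]
      simp
    obtain ⟨h1, h2⟩ := hθs _ (right_ne_zero_of_mul h')
    obtain ⟨h3, h4⟩ := hθs _ (right_ne_zero_of_mul (left_ne_zero_of_mul h'))
    refine ⟨h1, h2, h3, h4, ?_⟩
    by_contra! h5
    exact left_ne_zero_of_mul (left_ne_zero_of_mul h')
      (ratioCutoff_eq_zero he (by positivity) (by norm_num) (by linarith))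
  have hGs : ∀ p ∈ K, ContDiffAt ℝ (⊤ : ℕ∞) G p := by
    rintro p ⟨h1, h2, h3, h4, h5⟩
    have hp2 : p.2 ≠ 0 := by
      intro h
      rw [h] at h3
      norm_num at h3
    have hsum : p.1.2 + p.1.1 • p.2 ≠ 0 := by
      intro h
      have h6 : ‖p.1.2‖ = ‖p.1.1 • p.2‖ := by
        rw [eq_neg_of_add_eq_zero_left h, norm_neg]
      have h7 : ‖p.1.2‖ ^ 2 = p.1.1 ^ 2 * ‖p.2‖ ^ 2 := by
        rw [h6, norm_smul, mul_pow, Real.norm_eq_abs, sq_abs]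
      linarith
    have hn : ContDiffAt ℝ (⊤ : ℕ∞) (fun p : (ℝ × E3) × E3 => ‖p.2‖) p :=
      contDiffAt_snd.norm ℝ hp2
    refine (ContDiffAt.mul ?_ ?_).mul (Complex.ofRealCLM.contDiff.contDiffAt.comp p ?_)
    · have hsd : ContDiffAt ℝ (⊤ : ℕ∞) (fun p : (ℝ × E3) × E3 => p.1.2 + p.1.1 • p.2) p := by
        fun_prop
      exact Complex.ofRealCLM.contDiff.contDiffAt.comp p ((hsd.norm ℝ hsum).pow k)
    · refine hA.contDiffAt.comp p (ContDiffAt.prodMk ?_ (ContDiffAt.prodMk ?_ ?_))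
      · exact contDiffAt_fst.fst.mul hn
      · exact (hn.inv (norm_ne_zero_iff.2 hp2)).smul contDiffAt_snd
      · exact contDiffAt_fst.snd
    · refine ((contDiffAt_ratioCutoff ?_ contDiffAt_const (by positivity)).mul ?_).mul ?_
      · exact (contDiffAt_fst.fst.pow 2).mul (hn.pow 2)
      · exact hθ.contDiffAt.comp p contDiffAt_snd
      · exact hθ.contDiffAt.comp p contDiffAt_fst.snd
  obtain ⟨hGd, hGc⟩ := contDiff_and_hasCompactSupport_of_isCompact hK hG0 hGs
  refine exists_piece_bound (σ := s + k) (by positivity) hM hχ hχc hχz hχ0 hχ1 hGd hGc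
    (P₁ := fun _ => 0) (P₂ := fun z => (‖z‖⁻¹, ‖z‖⁻¹ • z))
    (R := fun z => ((‖z‖ ^ (s + k) : ℝ) : ℂ)) measurable_const (by fun_prop) (by fun_prop)
    zero_le_one ?_ ?_ ?_
  · intro ζ
    rw [Complex.norm_real, Real.norm_of_nonneg (by positivity), one_mul]
  · intro ξ η _ _ _ l hl
    refine localized_symbol_smul (κ := fun ξ η => ratioCutoff e (‖η‖ ^ 2) (‖ξ - η‖ ^ 2)) hhom
      ?_ ξ η hl
    intro ξ η l hl
    rw [← smul_sub]
    exact ratioCutoff_norm_smul _ _ hl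
  · intro ξ η hξ hη hξη hχη
    obtain ⟨hη1, hη2⟩ := hχs η hχη
    have ht : 0 < ‖ξ - η‖ := norm_pos_iff.2 (sub_ne_zero.2 hξη)
    set t := ‖ξ - η‖ with ht_def
    have hω : ‖t⁻¹ • (ξ - η)‖ = 1 := by
      rw [norm_smul, norm_inv, Real.norm_of_nonneg ht.le, ← ht_def, inv_mul_cancel₀ ht.ne']
    have hκ : ratioCutoff e (t⁻¹ ^ 2 * ‖η‖ ^ 2) 1 = ratioCutoff e (‖η‖ ^ 2) (t ^ 2) := by
      rw [← ratioCutoff_smul (l := t⁻¹ ^ 2) (a := ‖η‖ ^ 2) (by positivity)]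
      congr 1
      field_simp
    simp only [G, zero_add]
    rw [hκ, hθ1 η hη1 hη2, hθ1 _ hω.ge (by rw [hω]; norm_num), mul_one, mul_one]
    by_cases h0 : ratioCutoff e (‖η‖ ^ 2) (t ^ 2) = 0
    · simp [h0]
    · have h1 := norm_sq_lt_of_ratioCutoff_ne_zero he h0
      rw [← ht_def] at h1
      have hn : ‖t⁻¹ • η‖ = t⁻¹ * ‖η‖ := by
        rw [norm_smul, norm_inv, Real.norm_of_nonneg ht.le]
      have h2 : t⁻¹ * ‖η‖ ≤ δ := by
        rw [inv_mul_le_iff₀ ht]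
        apply le_of_sq_le_sq _ (by positivity)
        nlinarith [sq_nonneg t]
      have h3 := hmA (t⁻¹ • ξ) (t⁻¹ • η) (by rw [hn]; positivity) (by rwa [hn])
        (by rw [← smul_sub, hω]; norm_num) (by rw [← smul_sub, hω]; norm_num)
      rw [← smul_sub, hn, smul_smul, mul_inv, inv_inv, mul_assoc, mul_comm ‖η‖⁻¹, ← mul_assoc,
        mul_inv_cancel₀ ht.ne', one_mul] at h3
      have h4 := hhom t ht (t⁻¹ • ξ) (t⁻¹ • η)
      rw [smul_inv_smul₀ ht.ne', smul_inv_smul₀ ht.ne', h3] at h4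
      rw [← smul_add, sub_add_cancel, norm_smul, norm_inv, Real.norm_of_nonneg ht.le, h4,
        Real.rpow_add ht, Real.rpow_natCast, mul_pow]
      have htk : (t : ℂ) ^ k * ((t : ℂ)⁻¹) ^ k = 1 := by
        rw [← mul_pow, mul_inv_cancel₀ (by exact_mod_cast ht.ne'), one_pow]
      push_cast
      linear_combination -(‖ξ‖ : ℂ) ^ k * ((t ^ s : ℝ) : ℂ) *
        A (t⁻¹ * ‖η‖, ‖η‖⁻¹ • η, t⁻¹ • (ξ - η)) * (ratioCutoff e (‖η‖ ^ 2) (t ^ 2) : ℂ) * htk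

end LocalizedSymbols

section ComparableFrequencies

variable {s : ℝ} {k : ℕ} {M : ℝ} {m : E3 → E3 → ℂ} {e : ℝ}

theorem norm_ite_le_rpow {σ a : ℝ} (hσ : 0 ≤ σ) (ha : 0 < a) (z : E3) :
    ‖if a ≤ ‖z‖ ^ 2 then (1 : ℂ) else 0‖ ≤ (a ^ (σ / 2))⁻¹ * ‖z‖ ^ σ := by
  split_ifs with h
  · have h1 : ‖z‖ ^ σ = (‖z‖ ^ 2) ^ (σ / 2) := by
      rw [← Real.rpow_natCast, ← Real.rpow_mul (norm_nonneg _)]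
      congr 1
      push_cast
      ring
    rw [norm_one, h1, inv_mul_eq_div, one_le_div (by positivity)]
    exact Real.rpow_le_rpow ha.le h (by positivity)
  · rw [norm_zero]
    positivity

theorem measurable_ite_le_norm_sq (a : ℝ) :
    Measurable fun z : E3 => if a ≤ ‖z‖ ^ 2 then (1 : ℂ) else 0 :=
  Measurable.ite (measurableSet_le measurable_const (by fun_prop)) measurable_const measurable_const

theorem norm_lt_of_norm_sq_lt (he1 : e ≤ 1 / 16) {u v : E3} (h : ‖u‖ ^ 2 < e * ‖v‖ ^ 2) :
    4 * ‖u‖ < ‖v‖ := by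
  apply lt_of_pow_lt_pow_left₀ 2 (norm_nonneg _)
  nlinarith [sq_nonneg ‖v‖]

theorem isHighLowBounded_of_low_output (hs : 0 ≤ s) (hM : 3 < M)
    (hhom : ∀ l : ℝ, 0 < l → ∀ ξ η : E3, m (l • ξ) (l • η) = ((l ^ s : ℝ) : ℂ) * m ξ η)
    {δ : ℝ} (hδ : 0 < δ) {A : ℝ × E3 × E3 → ℂ} (hA : ContDiff ℝ (⊤ : ℕ∞) A)
    (hmA : ∀ ξ η : E3, 0 < ‖ξ‖ → ‖ξ‖ ≤ δ → 1 / 2 ≤ ‖η‖ → ‖η‖ ≤ 2 →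
      m ξ η = A (‖ξ‖, ‖ξ‖⁻¹ • ξ, η))
    (he : 0 < e) (he1 : e ≤ 1 / 16) (heδ : 4 * e ≤ δ ^ 2) :
    IsHighLowBounded (s + k) M fun ξ η =>
      ((‖ξ‖ ^ k : ℝ) : ℂ) * m ξ η * (ratioCutoff e (‖ξ‖ ^ 2) (‖η‖ ^ 2) : ℂ) := by
  obtain ⟨χ, hχ, hχc, hχz, hχ0, hχ1, hχs⟩ := exists_logarithmic_partition
  obtain ⟨θ, hθ, hθ1, hθs⟩ := exists_annular_cutoff
  let G : (ℝ × E3) × E3 → ℂ := fun p => ((p.1.1 ^ k : ℝ) : ℂ) * A (p.1.1, p.1.2, p.2) *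
      ((ratioCutoff e (p.1.1 ^ 2) (‖p.2‖ ^ 2) * θ p.2 * θ p.1.2 : ℝ) : ℂ)
  let K : Set ((ℝ × E3) × E3) := {p | 1 / 8 ≤ ‖p.1.2‖ ^ 2 ∧ ‖p.1.2‖ ^ 2 ≤ 5 ∧ 1 / 8 ≤ ‖p.2‖ ^ 2 ∧
    ‖p.2‖ ^ 2 ≤ 5 ∧ p.1.1 ^ 2 ≤ e * ‖p.2‖ ^ 2}
  have hKc : IsClosed K := by
    refine IsClosed.and ?_ (IsClosed.and ?_ (IsClosed.and ?_ (IsClosed.and ?_ ?_))) <;>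
      exact isClosed_le (by fun_prop) (by fun_prop)
  have hK : IsCompact K := by
    refine isCompact_of_isClosed_of_norm_le hKc (A := 3) fun p hp => ?_
    obtain ⟨h1, h2, h3, h4, h5⟩ := hp
    refine ⟨?_, ?_, ?_⟩
    · rw [Real.norm_eq_abs]
      apply abs_le_of_sq_le_sq _ (by norm_num)
      nlinarith
    · nlinarith [norm_nonneg p.1.2]
    · nlinarith [norm_nonneg p.2]
  have hG0 : ∀ p, p ∉ K → G p = 0 := by
    intro p hp
    by_contra h
    refine hp ?_
    have h' : ratioCutoff e (p.1.1 ^ 2) (‖p.2‖ ^ 2) * θ p.2 * θ p.1.2 ≠ 0 := by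
      intro h0
      apply h
      simp only [G]
      rw [h0]
      simp
    obtain ⟨h1, h2⟩ := hθs _ (right_ne_zero_of_mul h')
    obtain ⟨h3, h4⟩ := hθs _ (right_ne_zero_of_mul (left_ne_zero_of_mul h'))
    refine ⟨h1, h2, h3, h4, ?_⟩
    by_contra! h5
    exact left_ne_zero_of_mul (left_ne_zero_of_mul h')
      (ratioCutoff_eq_zero he (by positivity) (by positivity) h5.le)
  have hGs : ∀ p ∈ K, ContDiffAt ℝ (⊤ : ℕ∞) G p := by
    rintro p ⟨h1, h2, h3, h4, h5⟩
    have hn : ContDiffAt ℝ (⊤ : ℕ∞) (fun p : (ℝ × E3) × E3 => ‖p.2‖ ^ 2) p :=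
      contDiffAt_snd.norm_sq ℝ
    refine (ContDiffAt.mul ?_ ?_).mul (Complex.ofRealCLM.contDiff.contDiffAt.comp p ?_)
    · exact Complex.ofRealCLM.contDiff.contDiffAt.comp p (contDiffAt_fst.fst.pow k)
    · exact hA.contDiffAt.comp p (contDiffAt_fst.fst.prodMk
        (contDiffAt_fst.snd.prodMk contDiffAt_snd))
    · refine ((contDiffAt_ratioCutoff (contDiffAt_fst.fst.pow 2) hn (by positivity)).mul ?_).mul ?_
      · exact hθ.contDiffAt.comp p contDiffAt_snd
      · exact hθ.contDiffAt.comp p contDiffAt_fst.snd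
  obtain ⟨hGd, hGc⟩ := contDiff_and_hasCompactSupport_of_isCompact hK hG0 hGs
  refine exists_piece_bound (σ := s + k) (by positivity) hM hχ hχc hχz hχ0 hχ1 hGd hGc
    (P₁ := fun z => (‖z‖, ‖z‖⁻¹ • z)) (P₂ := fun _ => 0) (by fun_prop) measurable_const
    (measurable_ite_le_norm_sq (e / 3)) (by positivity)
    (norm_ite_le_rpow (by positivity) (by positivity)) ?_ ?_
  · intro ξ η _ _ _ l hl
    exact localized_symbol_smul (κ := fun ξ η => ratioCutoff e (‖ξ‖ ^ 2) (‖η‖ ^ 2)) hhom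
      (fun ξ η l hl => ratioCutoff_norm_smul _ _ hl) ξ η hl
  · intro ξ η hξ hη hξη hχη
    obtain ⟨hη1, hη2⟩ := hχs η hχη
    have ht : 0 < ‖ξ‖ := norm_pos_iff.2 hξ
    have hω : ‖‖ξ‖⁻¹ • ξ‖ = 1 := by
      rw [norm_smul, norm_inv, norm_norm, inv_mul_cancel₀ ht.ne']
    simp only [G, add_zero]
    rw [hθ1 η hη1 hη2, hθ1 _ hω.ge (by rw [hω]; norm_num), mul_one, mul_one]
    by_cases h0 : ratioCutoff e (‖ξ‖ ^ 2) (‖η‖ ^ 2) = 0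
    · simp [h0]
    · have h1 := norm_sq_lt_of_ratioCutoff_ne_zero he h0
      have h2 := norm_lt_of_norm_sq_lt he1 h1
      have h3 : 3 / 4 ≤ ‖ξ - η‖ := by
        have := norm_sub_norm_le η ξ
        rw [norm_sub_rev] at this
        linarith
      have h4 : ‖ξ‖ ≤ δ := by
        apply le_of_sq_le_sq _ hδ.le
        have h5 : ‖η‖ ^ 2 ≤ 4 := by nlinarith
        nlinarith [mul_le_mul_of_nonneg_left h5 he.le]
      rw [if_pos (by nlinarith), one_mul, hmA ξ η ht h4 (by linarith) hη2]

/-- The cutoff of the region in which the three frequencies are comparable. -/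
noncomputable def middleCutoff (e : ℝ) (ξ η : E3) : ℝ :=
  1 - ratioCutoff e (‖η‖ ^ 2) (‖ξ - η‖ ^ 2) - ratioCutoff e (‖ξ - η‖ ^ 2) (‖η‖ ^ 2) -
    ratioCutoff e (‖ξ‖ ^ 2) (‖η‖ ^ 2)

theorem norm_sq_le_of_middleCutoff_ne_zero (he : 0 < e) (he1 : e ≤ 1 / 16) {ξ η : E3} (hη : η ≠ 0)
    (h : middleCutoff e ξ η ≠ 0) :
    e / 3 * ‖ξ - η‖ ^ 2 ≤ ‖η‖ ^ 2 ∧ e / 3 * ‖η‖ ^ 2 ≤ ‖ξ - η‖ ^ 2 ∧ e / 3 * ‖η‖ ^ 2 ≤ ‖ξ‖ ^ 2 := by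
  have hη0 : 0 < ‖η‖ := norm_pos_iff.2 hη
  have t1 : ‖ξ - η‖ ≤ ‖ξ‖ + ‖η‖ := norm_sub_le _ _
  have t2 : ‖η‖ ≤ ‖ξ‖ + ‖ξ - η‖ := by
    have := norm_sub_le ξ (ξ - η)
    rwa [sub_sub_cancel] at this
  have z1 : ∀ u v : E3, ‖v‖ ≤ 4 * ‖u‖ → ratioCutoff e (‖u‖ ^ 2) (‖v‖ ^ 2) = 0 := by
    intro u v huv
    by_contra h0
    have := norm_lt_of_norm_sq_lt he1 (norm_sq_lt_of_ratioCutoff_ne_zero he h0)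
    linarith
  have o1 : ∀ u v : E3, 0 < ‖v‖ → ‖u‖ ^ 2 < e / 3 * ‖v‖ ^ 2 →
      ratioCutoff e (‖u‖ ^ 2) (‖v‖ ^ 2) = 1 ∧ 4 * ‖u‖ < ‖v‖ := by
    intro u v hv huv
    refine ⟨ratioCutoff_eq_one he (by linarith) (by positivity) (by positivity) huv.le, ?_⟩
    apply norm_lt_of_norm_sq_lt he1 (huv.trans_le _)
    gcongr
    linarith
  unfold middleCutoff at h
  refine ⟨?_, ?_, ?_⟩ <;> by_contra! h'
  · have hζ : 0 < ‖ξ - η‖ := by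
      rcases (norm_nonneg (ξ - η)).eq_or_lt with h0 | h0
      · rw [← h0] at h'
        nlinarith
      · exact h0
    obtain ⟨a1, a2⟩ := o1 _ _ hζ h'
    apply h
    rw [a1, z1 (ξ - η) η (by linarith), z1 ξ η (by linarith)]
    norm_num
  · obtain ⟨a1, a2⟩ := o1 _ _ hη0 h'
    apply h
    rw [a1, z1 η (ξ - η) (by linarith), z1 ξ η (by linarith)]
    norm_num
  · obtain ⟨a1, a2⟩ := o1 _ _ hη0 h'
    apply h
    rw [a1, z1 η (ξ - η) (by linarith), z1 (ξ - η) η (by linarith)]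
    norm_num

theorem isHighLowBounded_of_comparable (hs : 0 ≤ s) (hM : 3 < M)
    (hhom : ∀ l : ℝ, 0 < l → ∀ ξ η : E3, m (l • ξ) (l • η) = ((l ^ s : ℝ) : ℂ) * m ξ η)
    (hm : ContDiffOn ℝ (⊤ : ℕ∞) (fun p : E3 × E3 => m p.1 p.2)
      {p : E3 × E3 | p.1 ≠ 0 ∧ p.2 ≠ 0 ∧ p.1 ≠ p.2})
    (he : 0 < e) (he1 : e ≤ 1 / 16) :
    IsHighLowBounded (s + k) M fun ξ η =>
      ((‖ξ‖ ^ k : ℝ) : ℂ) * m ξ η * (middleCutoff e ξ η : ℂ) := by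
  obtain ⟨χ, hχ, hχc, hχz, hχ0, hχ1, hχs⟩ := exists_logarithmic_partition
  obtain ⟨θ, hθ, hθ1, hθs⟩ := exists_annular_cutoff
  let G : (ℝ × E3) × E3 → ℂ := fun p =>
    ((‖p.1.2 + p.2‖ ^ k : ℝ) : ℂ) * m (p.1.2 + p.2) p.2 *
      ((middleCutoff e (p.1.2 + p.2) p.2 * θ p.2 * Real.smoothTransition (1 - p.1.1 ^ 2) : ℝ) : ℂ)
  let K : Set ((ℝ × E3) × E3) := {p | p.1.1 ^ 2 ≤ 1 ∧ 1 / 8 ≤ ‖p.2‖ ^ 2 ∧ ‖p.2‖ ^ 2 ≤ 5 ∧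
    e / 3 * ‖p.1.2‖ ^ 2 ≤ ‖p.2‖ ^ 2 ∧ e / 3 * ‖p.2‖ ^ 2 ≤ ‖p.1.2‖ ^ 2 ∧
    e / 3 * ‖p.2‖ ^ 2 ≤ ‖p.1.2 + p.2‖ ^ 2}
  have hKc : IsClosed K := by
    refine IsClosed.and ?_ (IsClosed.and ?_ (IsClosed.and ?_ (IsClosed.and ?_
      (IsClosed.and ?_ ?_)))) <;>
      exact isClosed_le (by fun_prop) (by fun_prop)
  have hK : IsCompact K := by
    refine isCompact_of_isClosed_of_norm_le hKc (A := 3 + 15 / e) fun p hp => ?_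
    obtain ⟨h1, h2, h3, h4, h5, h6⟩ := hp
    have he' : 0 < 15 / e := by positivity
    have h7 : ‖p.1.2‖ ^ 2 ≤ 15 / e := by
      rw [le_div_iff₀ he]
      nlinarith
    refine ⟨?_, ?_, ?_⟩
    · have : ‖p.1.1‖ ≤ 1 := by
        rw [Real.norm_eq_abs]
        exact abs_le_of_sq_le_sq (by linarith) (by norm_num)
      linarith
    · nlinarith [norm_nonneg p.1.2, sq_nonneg (‖p.1.2‖ - 1)]
    · nlinarith [norm_nonneg p.2]
  have hG0 : ∀ p, p ∉ K → G p = 0 := by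
    intro p hp
    by_contra h
    refine hp ?_
    have h' : middleCutoff e (p.1.2 + p.2) p.2 * θ p.2 *
        Real.smoothTransition (1 - p.1.1 ^ 2) ≠ 0 := by
      intro h0
      apply h
      simp only [G]
      rw [h0]
      simp
    obtain ⟨h3, h4⟩ := hθs _ (right_ne_zero_of_mul (left_ne_zero_of_mul h'))
    have hp2 : p.2 ≠ 0 := by
      intro h
      rw [h] at h3
      norm_num at h3
    obtain ⟨h5, h6, h7⟩ := norm_sq_le_of_middleCutoff_ne_zero he he1 hp2
      (left_ne_zero_of_mul (left_ne_zero_of_mul h'))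
    rw [add_sub_cancel_right] at h5 h6
    refine ⟨?_, h3, h4, h5, h6, h7⟩
    by_contra! h8
    exact right_ne_zero_of_mul h' (Real.smoothTransition.zero_of_nonpos (by linarith))
  have hGs : ∀ p ∈ K, ContDiffAt ℝ (⊤ : ℕ∞) G p := by
    rintro p ⟨h1, h2, h3, h4, h5, h6⟩
    have hp2 : p.2 ≠ 0 := by
      intro h
      rw [h] at h2
      norm_num at h2
    have hpos : 0 < e / 3 * ‖p.2‖ ^ 2 := by positivity
    have hp1 : p.1.2 ≠ 0 := by
      intro h
      rw [h, norm_zero] at h5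
      nlinarith
    have hsum : p.1.2 + p.2 ≠ 0 := by
      intro h
      rw [h, norm_zero] at h6
      nlinarith
    have hsd : ContDiffAt ℝ (⊤ : ℕ∞) (fun p : (ℝ × E3) × E3 => p.1.2 + p.2) p := by fun_prop
    have hn2 : ContDiffAt ℝ (⊤ : ℕ∞) (fun p : (ℝ × E3) × E3 => ‖p.2‖ ^ 2) p :=
      contDiffAt_snd.norm_sq ℝ
    have hn1 : ContDiffAt ℝ (⊤ : ℕ∞) (fun p : (ℝ × E3) × E3 => ‖p.1.2 + p.2 - p.2‖ ^ 2) p :=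
      (hsd.sub contDiffAt_snd).norm_sq ℝ
    have hn3 : ContDiffAt ℝ (⊤ : ℕ∞) (fun p : (ℝ × E3) × E3 => ‖p.1.2 + p.2‖ ^ 2) p :=
      hsd.norm_sq ℝ
    have hopen : IsOpen {p : E3 × E3 | p.1 ≠ 0 ∧ p.2 ≠ 0 ∧ p.1 ≠ p.2} :=
      (isOpen_ne_fun continuous_fst continuous_const).inter
        ((isOpen_ne_fun continuous_snd continuous_const).inter
          (isOpen_ne_fun continuous_fst continuous_snd))
    have hmAt : ContDiffAt ℝ (⊤ : ℕ∞) (fun p : E3 × E3 => m p.1 p.2) (p.1.2 + p.2, p.2) :=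
      hm.contDiffAt (hopen.mem_nhds ⟨hsum, hp2, by simpa using hp1⟩)
    refine (ContDiffAt.mul ?_ ?_).mul (Complex.ofRealCLM.contDiff.contDiffAt.comp p ?_)
    · exact Complex.ofRealCLM.contDiff.contDiffAt.comp p ((hsd.norm ℝ hsum).pow k)
    · exact hmAt.comp p (hsd.prodMk contDiffAt_snd)
    · refine (ContDiffAt.mul ?_ (hθ.contDiffAt.comp p contDiffAt_snd)).mul
        (Real.smoothTransition.contDiff.contDiffAt.comp p
          (contDiffAt_const.sub (contDiffAt_fst.fst.pow 2)))
      exact ((contDiffAt_const.sub (contDiffAt_ratioCutoff hn2 hn1 (by positivity))).sub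
        (contDiffAt_ratioCutoff hn1 hn2 (by positivity))).sub
        (contDiffAt_ratioCutoff hn3 hn2 (by positivity))
  obtain ⟨hGd, hGc⟩ := contDiff_and_hasCompactSupport_of_isCompact hK hG0 hGs
  refine exists_piece_bound (σ := s + k) (by positivity) hM hχ hχc hχz hχ0 hχ1 hGd hGc
    (P₁ := fun _ => 0) (P₂ := fun z => (0, z)) measurable_const (by fun_prop)
    (measurable_ite_le_norm_sq (e / 3)) (by positivity)
    (norm_ite_le_rpow (by positivity) (by positivity)) ?_ ?_
  · intro ξ η _ _ _ l hl
    refine localized_symbol_smul (κ := middleCutoff e) hhom (fun ξ η l hl => ?_) ξ η hl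
    unfold middleCutoff
    rw [← smul_sub, ratioCutoff_norm_smul _ _ hl, ratioCutoff_norm_smul _ _ hl,
      ratioCutoff_norm_smul _ _ hl]
  · intro ξ η hξ hη hξη hχη
    obtain ⟨hη1, hη2⟩ := hχs η hχη
    simp only [G, zero_add, sub_add_cancel]
    rw [hθ1 η hη1 hη2, Real.smoothTransition.one_of_one_le (by norm_num), mul_one, mul_one]
    by_cases h0 : middleCutoff e ξ η = 0
    · simp [h0]
    · obtain ⟨-, h1, -⟩ := norm_sq_le_of_middleCutoff_ne_zero he he1 hη h0
      have h2 : 1 ≤ ‖η‖ ^ 2 := by nlinarith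
      have h3 : e / 3 ≤ ‖ξ - η‖ ^ 2 := by
        nlinarith [mul_le_mul_of_nonneg_left h2 he.le]
      rw [if_pos h3, one_mul]

end ComparableFrequencies

section Assembly

theorem integral_fourier_swap (N : E3 → E3 → ℂ) (f g : E3 → ℂ) (ξ : E3) :
    ∫ η, N ξ (ξ - η) * g η * f (ξ - η) = ∫ η, N ξ η * f η * g (ξ - η) := by
  rw [← integral_sub_left_eq_self (fun η => N ξ η * f η * g (ξ - η)) volume ξ]
  congr with η
  rw [sub_sub_cancel]
  ring

theorem integrable_fourier_swap {N : E3 → E3 → ℂ} {f g : E3 → ℂ} {ξ : E3}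
    (h : Integrable fun η => N ξ (ξ - η) * g η * f (ξ - η)) :
    Integrable fun η => N ξ η * f η * g (ξ - η) := by
  refine (h.comp_sub_left ξ).congr (.of_forall fun η => ?_)
  simp only [sub_sub_cancel]
  ring

theorem exists_eLpNorm_le_of_split {σ M : ℝ} {N N₁ N₂ N₃ N₄ : E3 → E3 → ℂ}
    (h₁ : IsHighLowBounded σ M N₁) (h₂ : IsHighLowBounded σ M fun ξ η => N₂ ξ (ξ - η))
    (h₃ : IsHighLowBounded σ M N₃) (h₄ : IsHighLowBounded σ M N₄)
    (hN : ∀ ξ η, N ξ η = N₁ ξ η + N₂ ξ η + N₃ ξ η + N₄ ξ η) :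
    ∃ C : ℝ, 0 ≤ C ∧ ∀ f g : SchwartzMap E3 ℂ,
      eLpNorm (fun ξ => ∫ η, N ξ η * 𝓕 (f : E3 → ℂ) η * 𝓕 (g : E3 → ℂ) (ξ - η)) 2 volume ≤
        ENNReal.ofReal C * (sobolevH σ f * sobolevW1 M g + sobolevW1 M f * sobolevH σ g) := by
  obtain ⟨C₁, hC₁, h₁⟩ := h₁
  obtain ⟨C₂, hC₂, h₂⟩ := h₂
  obtain ⟨C₃, hC₃, h₃⟩ := h₃
  obtain ⟨C₄, hC₄, h₄⟩ := h₄
  refine ⟨C₁ + C₂ + C₃ + C₄, by positivity, fun f g => ?_⟩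
  obtain ⟨i₁, m₁, b₁⟩ := h₁ f g
  obtain ⟨i₂, m₂, b₂⟩ := h₂ g f
  obtain ⟨i₃, m₃, b₃⟩ := h₃ f g
  obtain ⟨i₄, m₄, b₄⟩ := h₄ f g
  simp_rw [integral_fourier_swap N₂] at m₂ b₂
  set I : (E3 → E3 → ℂ) → E3 → ℂ := fun N ξ =>
    ∫ η, N ξ η * 𝓕 (f : E3 → ℂ) η * 𝓕 (g : E3 → ℂ) (ξ - η) with hI
  have hsum : I N =ᵐ[volume] I N₁ + I N₂ + I N₃ + I N₄ := by
    have h0 : ∀ᵐ ξ : E3, ξ ≠ 0 := by simp [ae_iff]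
    filter_upwards [h0] with ξ hξ
    have j₁ := i₁ ξ hξ
    have j₂ := integrable_fourier_swap (i₂ ξ hξ)
    have j₃ := i₃ ξ hξ
    have j₄ := i₄ ξ hξ
    simp only [Pi.add_apply, hI]
    rw [← integral_add' j₁ j₂, ← integral_add' (j₁.add j₂) j₃,
      ← integral_add' ((j₁.add j₂).add j₃) j₄]
    congr with η
    rw [hN]
    simp only [Pi.add_apply]
    ring
  have htri : eLpNorm (I N) 2 volume ≤ eLpNorm (I N₁) 2 volume + eLpNorm (I N₂) 2 volume +
      eLpNorm (I N₃) 2 volume + eLpNorm (I N₄) 2 volume := by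
    rw [eLpNorm_congr_ae hsum]
    refine (eLpNorm_add_le ((m₁.add m₂).add m₃) m₄ one_le_two).trans ?_
    gcongr
    refine (eLpNorm_add_le (m₁.add m₂) m₃ one_le_two).trans ?_
    gcongr
    exact eLpNorm_add_le m₁ m₂ one_le_two
  refine htri.trans ((add_le_add (add_le_add (add_le_add b₁ b₂) b₃) b₄).trans ?_)
  rw [ENNReal.ofReal_add (by positivity) hC₄, ENNReal.ofReal_add (by positivity) hC₃,
    ENNReal.ofReal_add hC₁ hC₂, add_mul, add_mul, add_mul, mul_comm (sobolevW1 M g)]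
  gcongr <;> first | exact le_add_self | exact le_self_add

end Assembly

end PseudoProduct

/-- The L² estimate ‖Λᵏ T_m(f,g)‖₂ ≲ ‖f‖_{H^{s+k}} ‖g‖_{W^{1,M}} + ‖f‖_{W^{1,M}} ‖g‖_{H^{s+k}}
for symbols in the class 𝓑_s (homogeneous of degree s, smooth away from
{ξ = 0} ∪ {η = 0} ∪ {ξ = η}, with smooth angular structure near the axes) and M > 3. -/
theorem pseudoProduct_bound_Bs
    (s : ℝ) (hs : 0 ≤ s) (k : ℕ) (M : ℝ) (hM : 3 < M)
    (m : EuclideanSpace ℝ (Fin 3) → EuclideanSpace ℝ (Fin 3) → ℂ)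
    (hhom : ∀ l : ℝ, 0 < l → ∀ ξ η : EuclideanSpace ℝ (Fin 3),
      m (l • ξ) (l • η) = ((l ^ s : ℝ) : ℂ) * m ξ η)
    (hsmooth : ContDiffOn ℝ (⊤ : ℕ∞)
      (fun p : EuclideanSpace ℝ (Fin 3) × EuclideanSpace ℝ (Fin 3) => m p.1 p.2)
      {p : EuclideanSpace ℝ (Fin 3) × EuclideanSpace ℝ (Fin 3) |
        p.1 ≠ 0 ∧ p.2 ≠ 0 ∧ p.1 ≠ p.2})
    (hlabel : ∀ i j : Fin 3, i ≠ j →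
      ∃ δ : ℝ, 0 < δ ∧
        ∃ A : ℝ × EuclideanSpace ℝ (Fin 3) × EuclideanSpace ℝ (Fin 3) → ℂ,
          ContDiff ℝ (⊤ : ℕ∞) A ∧
          ∀ ξ η : EuclideanSpace ℝ (Fin 3),
            0 < ‖![ξ, η, ξ - η] i‖ → ‖![ξ, η, ξ - η] i‖ ≤ δ →
            1 / 2 ≤ ‖![ξ, η, ξ - η] j‖ → ‖![ξ, η, ξ - η] j‖ ≤ 2 →
            m ξ η = A (‖![ξ, η, ξ - η] i‖,
              ‖![ξ, η, ξ - η] i‖⁻¹ • ![ξ, η, ξ - η] i, ![ξ, η, ξ - η] j)) :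
    ∃ C : ℝ, 0 < C ∧ ∀ f g : SchwartzMap (EuclideanSpace ℝ (Fin 3)) ℂ,
      eLpNorm (lambdaPow k (pseudoProduct m ⇑f ⇑g)) 2 volume ≤
        ENNReal.ofReal C *
          (sobolevH (s + k) ⇑f * sobolevW1 M ⇑g + sobolevW1 M ⇑f * sobolevH (s + k) ⇑g) := by
  obtain ⟨δ₁, hδ₁, A₁, hA₁, hm₁⟩ := hlabel 1 2 (by decide)
  obtain ⟨δ₂, hδ₂, A₂, hA₂, hm₂⟩ := hlabel 2 1 (by decide)
  obtain ⟨δ₃, hδ₃, A₃, hA₃, hm₃⟩ := hlabel 0 1 (by decide)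
  obtain ⟨e, he, he0, he1, he2, he3⟩ : ∃ e : ℝ, 0 < e ∧ e ≤ 1 / 16 ∧ 4 * e ≤ δ₁ ^ 2 ∧
      4 * e ≤ δ₂ ^ 2 ∧ 4 * e ≤ δ₃ ^ 2 := by
    refine ⟨min (1 / 16) (min (δ₁ ^ 2 / 4) (min (δ₂ ^ 2 / 4) (δ₃ ^ 2 / 4))), ?_, ?_, ?_, ?_, ?_⟩
    · positivity
    all_goals
      have h1 := min_le_left (1 / 16) (min (δ₁ ^ 2 / 4) (min (δ₂ ^ 2 / 4) (δ₃ ^ 2 / 4)))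
      have h2 := min_le_right (1 / 16) (min (δ₁ ^ 2 / 4) (min (δ₂ ^ 2 / 4) (δ₃ ^ 2 / 4)))
      have h3 := min_le_left (δ₁ ^ 2 / 4) (min (δ₂ ^ 2 / 4) (δ₃ ^ 2 / 4))
      have h4 := min_le_right (δ₁ ^ 2 / 4) (min (δ₂ ^ 2 / 4) (δ₃ ^ 2 / 4))
      have h5 := min_le_left (δ₂ ^ 2 / 4) (δ₃ ^ 2 / 4)
      have h6 := min_le_right (δ₂ ^ 2 / 4) (δ₃ ^ 2 / 4)
      linarith
  have H₁ := PseudoProduct.isHighLowBounded_of_low_frequency (k := k) hs hM hhom hδ₁ hA₁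
    (fun ξ η => hm₁ ξ η) he he0 he1
  have H₂ := PseudoProduct.isHighLowBounded_of_low_frequency (k := k)
    (m := fun ξ η => m ξ (ξ - η)) hs hM
    (fun l hl ξ η => by rw [← smul_sub]; exact hhom l hl _ _) hδ₂ hA₂
    (fun ξ η => by simpa using hm₂ ξ (ξ - η)) he he0 he2
  have H₃ := PseudoProduct.isHighLowBounded_of_low_output (k := k) hs hM hhom hδ₃ hA₃
    (fun ξ η => hm₃ ξ η) he he0 he3
  have H₄ := PseudoProduct.isHighLowBounded_of_comparable (k := k) hs hM hhom hsmooth he he0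
  obtain ⟨C, hC, h⟩ := PseudoProduct.exists_eLpNorm_le_of_split
    (N := fun ξ η => ((‖ξ‖ ^ k : ℝ) : ℂ) * m ξ η)
    (N₂ := fun ξ η => ((‖ξ‖ ^ k : ℝ) : ℂ) * m ξ η *
      (PseudoProduct.ratioCutoff e (‖ξ - η‖ ^ 2) (‖η‖ ^ 2) : ℂ)) H₁
    (by simpa only [sub_sub_cancel] using H₂) H₃ H₄ (fun ξ η => by
      simp only [PseudoProduct.middleCutoff]
      push_cast
      ring)
  refine ⟨(2 * Real.pi) ^ k * C + 1, by positivity, fun f g => ?_⟩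
  refine (PseudoProduct.eLpNorm_lambdaPow_pseudoProduct_le m k f g).trans ?_
  have h1 := h f g
  simp_rw [mul_assoc, integral_const_mul] at h1
  simp_rw [mul_assoc _ (𝓕 (f : EuclideanSpace ℝ (Fin 3) → ℂ) _)]
  refine (mul_le_mul_right h1 _).trans ?_
  rw [← mul_assoc, ← ENNReal.ofReal_mul (by positivity)]
  gcongr
  linarith
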